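/- Let 0 < α < 1. For smooth functions f, g: 𝕋² → ℝ define T[f,g] = Λ^{−1}((Λf)g − f(Λg)); the function (Λf)g − f(Λg) has zero mean (since Λ is self-adjoint), so Λ^{−1} applies. Then for every integer N ≥ 0, ‖T[f,g]‖_{N+α} ≲ ‖f‖_{N+α}‖g‖_α + ‖f‖_α‖g‖_{N+α}, with implicit constant depending only on α and N. -/

import Mathlib

/-!
Common setup: functions on the torus `𝕋^d = ℝ^d/(2πℤ)^d` are modelled as
`2π`-periodic functions on `ℝ^d = Fin d → ℝ`, with Fourier coefficients,
Fourier multiplier operators, Hölder norms, etc.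
-/

noncomputable section

open scoped BigOperators
open MeasureTheory

/-- Points of `ℝ^d` (covering the torus `𝕋^d = ℝ^d/(2πℤ)^d`). -/
abbrev Vd (d : ℕ) := Fin d → ℝ

/-- The lattice vector `2π m`. -/
def latt {d : ℕ} (m : Fin d → ℤ) : Vd d := fun i => 2 * Real.pi * (m i : ℝ)

/-- `f` is `2π`-periodic in each coordinate, i.e. a function on the torus `𝕋^d`. -/
def TorusFun {d : ℕ} {F : Type*} (f : Vd d → F) : Prop :=
  ∀ (x : Vd d) (m : Fin d → ℤ), f (x + latt m) = f x

/-- Dot product of an integer frequency with a point of `ℝ^d`. -/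
def dotZ {d : ℕ} (k : Fin d → ℤ) (x : Vd d) : ℝ := ∑ i, (k i : ℝ) * x i

/-- The Euclidean norm on `ℝ^d`. -/
def eNorm {d : ℕ} (x : Vd d) : ℝ := Real.sqrt (∑ i, (x i) ^ 2)

/-- `|k|` for an integer frequency `k ∈ ℤ^d`. -/
def kAbs {d : ℕ} (k : Fin d → ℤ) : ℝ := eNorm (fun i => (k i : ℝ))

/-- The fundamental domain `[0,2π]^d`. -/
def box (d : ℕ) : Set (Vd d) := Set.Icc 0 (fun _ => 2 * Real.pi)

/-- Mean-zero (real-valued) function on the torus. -/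
def MeanZeroR {d : ℕ} (f : Vd d → ℝ) : Prop := ∫ x in box d, f x = 0

/-- Fourier coefficient `f̂(k)` of a function on the torus. -/
def fCoeff {d : ℕ} (f : Vd d → ℂ) (k : Fin d → ℤ) : ℂ :=
  (((2 * Real.pi) ^ d)⁻¹ : ℝ) • ∫ x in box d, f x * Complex.exp (-(Complex.I * (dotZ k x : ℂ)))

/-- Fourier multiplier operator with symbol `m : ℤ^d → ℂ`. -/
def fmul {d : ℕ} (m : (Fin d → ℤ) → ℂ) (f : Vd d → ℂ) : Vd d → ℂ :=
  fun x => ∑' k : Fin d → ℤ, m k * fCoeff f k * Complex.exp (Complex.I * (dotZ k x : ℂ))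

/-- `Λ^s = (-Δ)^{s/2}`: Fourier multiplier with symbol `|k|^s` (acting on mean-zero parts). -/
def LamPow {d : ℕ} (s : ℝ) : (Vd d → ℂ) → Vd d → ℂ :=
  fmul (fun k => if k = 0 then 0 else (((kAbs k) ^ s : ℝ) : ℂ))

/-- `Λ = (-Δ)^{1/2}`. -/
def Lam1 {d : ℕ} : (Vd d → ℂ) → Vd d → ℂ := LamPow 1

/-- `i`-th component of the SQG operator `∇^⊥Λ^{-1} = (-∂₂Λ^{-1}, ∂₁Λ^{-1})`,
with symbols `(-i k₂/|k|, i k₁/|k|)`. -/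
def sqgOp (i : Fin 2) : (Vd 2 → ℂ) → Vd 2 → ℂ :=
  fmul (fun k => if k = 0 then 0 else
    (if i = 0 then -(Complex.I * (k 1 : ℂ)) else Complex.I * (k 0 : ℂ)) / ((kAbs k : ℝ) : ℂ))

/-- First-order partial derivative `∂_i`. -/
def pd {d : ℕ} {F : Type*} [NormedAddCommGroup F] [NormedSpace ℝ F]
    (i : Fin d) (f : Vd d → F) (x : Vd d) : F :=
  fderiv ℝ f x (Pi.single i 1)

/-- Complexification of a real-valued function. -/
def cplx {d : ℕ} (f : Vd d → ℝ) : Vd d → ℂ := fun x => (f x : ℂ)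

/-- The `C^N` norm: sum of sup-norms of the iterated derivatives of order `≤ N`. -/
def CkNorm {d : ℕ} {F : Type*} [NormedAddCommGroup F] [NormedSpace ℝ F]
    (N : ℕ) (f : Vd d → F) : ℝ :=
  ∑ n ∈ Finset.range (N + 1), ⨆ x : Vd d, ‖iteratedFDeriv ℝ n f x‖

/-- The `α`-Hölder seminorm. -/
def hSemi {d : ℕ} {F : Type*} [NormedAddCommGroup F] (α : ℝ) (f : Vd d → F) : ℝ :=
  ⨆ p : Vd d × Vd d, if p.1 = p.2 then 0 else ‖f p.1 - f p.2‖ / ‖p.1 - p.2‖ ^ α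

/-- The `C^{N,α}` Hölder norm `‖f‖_{N+α}`. -/
def HolNorm {d : ℕ} {F : Type*} [NormedAddCommGroup F] [NormedSpace ℝ F]
    (N : ℕ) (α : ℝ) (f : Vd d → F) : ℝ :=
  CkNorm N f + hSemi α (iteratedFDeriv ℝ N f)

/-- `∇^⊥·div R` for a `2`-tensor field `R` on `ℝ²` (values in any normed space). -/
def perpDivDiv {F : Type*} [NormedAddCommGroup F] [NormedSpace ℝ F]
    (R : Vd 2 → Fin 2 → Fin 2 → F) (x : Vd 2) : F :=
  - pd 1 (fun y => ∑ j, pd j (fun z => R z 0 j) y) x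
  + pd 0 (fun y => ∑ j, pd j (fun z => R z 1 j) y) x

/-- Material derivative `D_t f = ∂_t f + u·∇f`. -/
def matD (u : ℝ → Vd 2 → Fin 2 → ℝ) (f : ℝ → Vd 2 → ℝ) (t : ℝ) (x : Vd 2) : ℝ :=
  deriv (fun s => f s x) t + ∑ i, u t x i * pd i (f t) x

/-- The SQG–Reynolds system `∂_tθ + u·∇θ = ∇^⊥·div R`, `u = ∇^⊥Λ^{-1}θ`,
for smooth space-periodic data with `R` symmetric. -/
structure SQGReynolds (θ : ℝ → Vd 2 → ℝ) (u : ℝ → Vd 2 → Fin 2 → ℝ)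
    (R : ℝ → Vd 2 → Fin 2 → Fin 2 → ℝ) : Prop where
  smooth_θ : ContDiff ℝ (⊤ : ℕ∞) fun p : ℝ × Vd 2 => θ p.1 p.2
  smooth_u : ContDiff ℝ (⊤ : ℕ∞) fun p : ℝ × Vd 2 => u p.1 p.2
  smooth_R : ContDiff ℝ (⊤ : ℕ∞) fun p : ℝ × Vd 2 => R p.1 p.2
  periodic_θ : ∀ t, TorusFun (θ t)
  periodic_u : ∀ t, TorusFun (u t)
  periodic_R : ∀ t, TorusFun (R t)
  symm_R : ∀ t x i j, R t x i j = R t x j i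
  vel : ∀ t x i, (u t x i : ℂ) = sqgOp i (cplx (θ t)) x
  eqn : ∀ t x, matD u θ t x = perpDivDiv (R t) x

/-- The bilinear operator `T[f,g] = Λ^{-1}((Λf)g - f(Λg))`. -/
def Tbil (f g : Vd 2 → ℂ) : Vd 2 → ℂ :=
  LamPow (-1) (fun x => Lam1 f x * g x - f x * Lam1 g x)

/-- A Littlewood–Paley bump: smooth, spherically symmetric, `ψ = 1` on `B₁(0)`,
`supp ψ ⊂ B_{3/2}(0)`. -/
structure LPfun {d : ℕ} (ψ : Vd d → ℝ) : Prop where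
  smooth : ContDiff ℝ (⊤ : ℕ∞) ψ
  radial : ∀ x y : Vd d, eNorm x = eNorm y → ψ x = ψ y
  supp : ∀ x, 3/2 ≤ eNorm x → ψ x = 0
  one : ∀ x, eNorm x ≤ 1 → ψ x = 1

/-- Littlewood–Paley block `Δ_j f` (with `Δ_{-1}f = f̂(0)`, `Δ_j f = 0` for `j < -1`). -/
def LPblock {d : ℕ} (ψ : Vd d → ℝ) (j : ℤ) (f : Vd d → ℂ) : Vd d → ℂ :=
  if j < -1 then 0
  else if j = -1 then fun _ => fCoeff f 0
  else fun x => ∑' k : Fin d → ℤ,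
    (((ψ (fun i => (k i : ℝ) / 2 ^ j) - ψ (fun i => (k i : ℝ) / 2 ^ (j - 1))) : ℝ) : ℂ)
      * fCoeff f k * Complex.exp (Complex.I * (dotZ k x : ℂ))

/-- Low-frequency projection `S_j f = Σ_{i ≤ j} Δ_i f`. -/
def LPlow {d : ℕ} (ψ : Vd d → ℝ) (j : ℤ) (f : Vd d → ℂ) : Vd d → ℂ :=
  if j < -1 then 0
  else if j = -1 then fun _ => fCoeff f 0
  else fun x => ∑' k : Fin d → ℤ,
    ((ψ (fun i => (k i : ℝ) / 2 ^ j) : ℝ) : ℂ)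
      * fCoeff f k * Complex.exp (Complex.I * (dotZ k x : ℂ))

/-! ### Characters of the torus and absolutely convergent trigonometric series -/

/-- The character `x ↦ e^{i k·x}` of the torus. -/
def tchar (k : Fin 2 → ℤ) (x : Vd 2) : ℂ := Complex.exp (Complex.I * (dotZ k x : ℂ))

/-- The trigonometric series `∑_j c_j e^{i κ_j·x}`. -/
def trig {ι : Type*} (κ : ι → Fin 2 → ℤ) (c : ι → ℂ) (x : Vd 2) : ℂ :=
  ∑' j, c j * tchar (κ j) x

lemma dotZ_eq (k : Fin 2 → ℤ) (x : Vd 2) : dotZ k x = k 0 * x 0 + k 1 * x 1 := by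
  simp [dotZ]

lemma dotZ_add (k : Fin 2 → ℤ) (x y : Vd 2) : dotZ k (x + y) = dotZ k x + dotZ k y := by
  simp [dotZ_eq]; ring

lemma continuous_dotZ (k : Fin 2 → ℤ) : Continuous (dotZ k) := by
  unfold dotZ; fun_prop

lemma norm_tchar (k : Fin 2 → ℤ) (x : Vd 2) : ‖tchar k x‖ = 1 := by
  rw [tchar, mul_comm, Complex.norm_exp_ofReal_mul_I]

lemma tchar_add (k : Fin 2 → ℤ) (x y : Vd 2) : tchar k (x + y) = tchar k x * tchar k y := by
  rw [tchar, tchar, tchar, ← Complex.exp_add, dotZ_add]; push_cast; ring_nf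

lemma tchar_add_left (k l : Fin 2 → ℤ) (x : Vd 2) :
    tchar (k + l) x = tchar k x * tchar l x := by
  rw [tchar, tchar, tchar, ← Complex.exp_add, dotZ_eq, dotZ_eq, dotZ_eq]
  congr 1; push_cast [Pi.add_apply]; ring

lemma tchar_latt (k m : Fin 2 → ℤ) : tchar k (latt m) = 1 := by
  rw [tchar, Complex.exp_eq_one_iff]
  refine ⟨k 0 * m 0 + k 1 * m 1, ?_⟩
  simp only [dotZ_eq, latt]; push_cast; ring

@[fun_prop]
lemma continuous_tchar (k : Fin 2 → ℤ) : Continuous (tchar k) := by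
  have := continuous_dotZ k
  unfold tchar; fun_prop

section Trig

variable {ι : Type*} {κ : ι → Fin 2 → ℤ} {c : ι → ℂ}

lemma summable_trig (hc : Summable fun j => ‖c j‖) (x : Vd 2) :
    Summable fun j => c j * tchar (κ j) x := by
  refine .of_norm ?_
  simpa [norm_tchar] using hc

lemma summable_norm_mul {m : ι → ℂ} {M : ℝ} (hm : ∀ j, ‖m j‖ ≤ M)
    (hc : Summable fun j => ‖c j‖) : Summable fun j => ‖m j * c j‖ := by
  refine Summable.of_nonneg_of_le (fun _ => norm_nonneg _) (fun j => ?_) (hc.mul_left M)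
  rw [norm_mul]
  exact mul_le_mul_of_nonneg_right (hm j) (norm_nonneg _)

/-- A multiplier which is the Fourier transform of a finite (complex) measure acts on
trigonometric series by averaging translations. -/
lemma trig_mul_eq_integral [Countable ι] {Ω : Type*} [MeasurableSpace Ω] {μ : Measure Ω}
    {X : Ω → Vd 2} {w : Ω → ℂ} (hX : Measurable X) (hw : Integrable w μ)
    {m : (Fin 2 → ℤ) → ℂ} (hm : ∀ k, m k = ∫ ω, w ω * tchar k (X ω) ∂μ)
    (hc : Summable fun j => ‖c j‖) (x : Vd 2) :
    trig κ (fun j => m (κ j) * c j) x = ∫ ω, w ω * trig κ c (x + X ω) ∂μ := by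
  have hintegrable : ∀ j, Integrable (fun ω => w ω * (c j * tchar (κ j) (x + X ω))) μ := by
    intro j
    refine hw.mul_bdd (c := ‖c j‖) ?_ (.of_forall fun ω => ?_)
    · exact ((((continuous_tchar (κ j)).measurable.comp (hX.const_add x))).const_mul
        _).aestronglyMeasurable
    · simp [norm_tchar]
  have key := integral_tsum_of_summable_integral_norm hintegrable (by
    simp only [norm_mul, norm_tchar, mul_one, integral_mul_const]
    exact hc.mul_left _)
  have e1 : ∀ ω, ∑' j, w ω * (c j * tchar (κ j) (x + X ω)) = w ω * trig κ c (x + X ω) :=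
    fun ω => tsum_mul_left
  simp only [e1] at key
  rw [← key, trig]
  refine tsum_congr fun j => ?_
  rw [hm, mul_assoc, ← integral_mul_const]
  refine integral_congr_ae (.of_forall fun ω => ?_)
  simp only [tchar_add]; ring

lemma trig_add {d : ι → ℂ} (hc : Summable fun j => ‖c j‖) (hd : Summable fun j => ‖d j‖)
    (x : Vd 2) : trig κ (fun j => c j + d j) x = trig κ c x + trig κ d x := by
  unfold trig
  rw [← (summable_trig hc x).tsum_add (summable_trig hd x)]
  refine tsum_congr fun j => ?_
  ring

lemma trig_const_mul (a : ℂ) (x : Vd 2) : trig κ (fun j => a * c j) x = a * trig κ c x := by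
  unfold trig
  rw [← tsum_mul_left]
  refine tsum_congr fun j => ?_
  ring

lemma trig_sum {σ : Type*} (s : Finset σ) {d : σ → ι → ℂ}
    (hd : ∀ i ∈ s, Summable fun j => ‖d i j‖) (x : Vd 2) :
    trig κ (fun j => ∑ i ∈ s, d i j) x = ∑ i ∈ s, trig κ (d i) x := by
  unfold trig
  rw [← Summable.tsum_finsetSum fun i hi => summable_trig (hd i hi) x]
  refine tsum_congr fun j => ?_
  rw [Finset.sum_mul]

lemma trig_diff (hc : Summable fun j => ‖c j‖) (x v : Vd 2) :
    trig κ (fun j => (tchar (κ j) v - 1) * c j) x = trig κ c (x + v) - trig κ c x := by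
  unfold trig
  rw [← (summable_trig hc (x + v)).tsum_sub (summable_trig hc x)]
  refine tsum_congr fun j => ?_
  rw [tchar_add]; ring

lemma summable_diff (hc : Summable fun j => ‖c j‖) (v : Vd 2) :
    Summable fun j => ‖(tchar (κ j) v - 1) * c j‖ := by
  refine summable_norm_mul (M := 2) (fun j => ?_) hc
  refine (norm_sub_le _ _).trans ?_
  rw [norm_tchar, norm_one]; norm_num

end Trig

/-! ### Gaussian representation of the Poisson kernel -/

open ProbabilityTheory in
/-- The standard Gaussian measure on `ℝ`. -/
abbrev stdG : Measure ℝ := gaussianReal 0 1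

lemma integral_exp_sub_div_sq {l : ℝ} (hl : 0 < l) :
    2 * ∫ x in Set.Ioi (0 : ℝ), Real.exp (-(x - l / x) ^ 2 / 2) = √(2 * Real.pi) := by
  set g : ℝ → ℝ := fun x => Real.exp (-(x - l / x) ^ 2 / 2) with hg
  have hgauss : Integrable fun u : ℝ => Real.exp (-u ^ 2 / 2) := by
    simpa [div_eq_inv_mul, mul_comm] using integrable_exp_neg_mul_sq (b := 2⁻¹) (by norm_num)
  have hgaussI : ∫ u : ℝ, Real.exp (-u ^ 2 / 2) = √(2 * Real.pi) := by
    have := integral_gaussian (2⁻¹)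
    simp only [div_inv_eq_mul] at this
    rw [mul_comm 2, ← this]
    congr 1; ext u; ring_nf
  have hd : ∀ x ∈ Set.Ioi (0 : ℝ),
      HasDerivWithinAt (fun x => x - l / x) (1 + l / x ^ 2) (Set.Ioi 0) x := by
    intro x hx
    have hx : x ≠ 0 := (Set.mem_Ioi.1 hx).ne'
    have h := (hasDerivAt_id x).sub ((hasDerivAt_inv hx).const_mul l)
    convert! h.hasDerivWithinAt using 1
    field_simp
    ring
  have hinj : Set.InjOn (fun x : ℝ => x - l / x) (Set.Ioi 0) := by
    intro x hx y hy hxy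
    rw [Set.mem_Ioi] at hx hy
    simp only at hxy
    field_simp at hxy
    have : (x - y) * (x * y + l) = 0 := by linarith
    rcases mul_eq_zero.1 this with h | h
    · linarith
    · nlinarith [mul_pos hx hy]
  have himg : (fun x : ℝ => x - l / x) '' Set.Ioi 0 = Set.univ := by
    refine Set.eq_univ_of_forall fun u => ?_
    have hs : √(u ^ 2 + 4 * l) ^ 2 = u ^ 2 + 4 * l := Real.sq_sqrt (by positivity)
    have hpos : 0 < u + √(u ^ 2 + 4 * l) := by
      have : |u| < √(u ^ 2 + 4 * l) := by
        rw [← Real.sqrt_sq_eq_abs]; exact Real.sqrt_lt_sqrt (by positivity) (by linarith)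
      linarith [neg_abs_le u]
    refine ⟨(u + √(u ^ 2 + 4 * l)) / 2, by simpa using hpos, ?_⟩
    simp only
    field_simp
    nlinarith
  have hd' : ∀ x ∈ Set.Ioi (0 : ℝ),
      HasDerivWithinAt (fun x => l / x) (-(l / x ^ 2)) (Set.Ioi 0) x := by
    intro x hx
    have hx : x ≠ 0 := (Set.mem_Ioi.1 hx).ne'
    have h := (hasDerivAt_inv hx).const_mul l
    convert! h.hasDerivWithinAt using 1
    field_simp
  have hinj' : Set.InjOn (fun x : ℝ => l / x) (Set.Ioi 0) := by
    intro x hx y hy hxy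
    rw [Set.mem_Ioi] at hx hy
    simp only at hxy
    rw [div_eq_div_iff hx.ne' hy.ne'] at hxy
    exact (mul_left_cancel₀ hl.ne' hxy).symm
  have himg' : (fun x : ℝ => l / x) '' Set.Ioi 0 = Set.Ioi 0 := by
    ext u
    constructor
    · rintro ⟨x, hx, rfl⟩; exact div_pos hl hx
    · intro hu
      exact ⟨l / u, div_pos hl hu, div_div_cancel₀ hl.ne'⟩
  have I1 := integral_image_eq_integral_abs_deriv_smul measurableSet_Ioi hd hinj
    (fun u => Real.exp (-u ^ 2 / 2))
  have I2 := integral_image_eq_integral_abs_deriv_smul measurableSet_Ioi hd' hinj' g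
  have J1 := (integrableOn_image_iff_integrableOn_abs_deriv_smul measurableSet_Ioi hd hinj
    (fun u => Real.exp (-u ^ 2 / 2))).1 (by rw [himg]; exact hgauss.integrableOn)
  rw [himg, setIntegral_univ, hgaussI] at I1
  rw [himg'] at I2
  have hgm : Measurable g := by rw [hg]; fun_prop
  have J2 : IntegrableOn g (Set.Ioi 0) := by
    refine Integrable.mono' J1 hgm.aestronglyMeasurable ?_
    refine (ae_restrict_iff' measurableSet_Ioi).2 (.of_forall fun x hx => ?_)
    rw [Set.mem_Ioi] at hx
    rw [Real.norm_of_nonneg (Real.exp_pos _).le, smul_eq_mul, abs_of_pos (by positivity)]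
    have : 0 < l / x ^ 2 := by positivity
    nlinarith [Real.exp_pos (-(x - l / x) ^ 2 / 2)]
  have J3 : IntegrableOn (fun x => l / x ^ 2 * g x) (Set.Ioi 0) := by
    refine (Integrable.sub J1 J2).congr ?_
    refine (ae_restrict_iff' measurableSet_Ioi).2 (.of_forall fun x hx => ?_)
    rw [Set.mem_Ioi] at hx
    simp only [Pi.sub_apply, smul_eq_mul]
    rw [abs_of_pos (by positivity)]
    ring
  have e2 : ∫ x in Set.Ioi (0 : ℝ), g x = ∫ x in Set.Ioi (0 : ℝ), l / x ^ 2 * g x := by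
    rw [I2]
    refine setIntegral_congr_fun measurableSet_Ioi fun x hx => ?_
    rw [Set.mem_Ioi] at hx
    simp only [smul_eq_mul, hg, div_div_cancel₀ hl.ne']
    rw [abs_neg, abs_of_pos (by positivity)]
    congr 3; ring
  rw [two_mul]
  nth_rewrite 2 [e2]
  rw [← integral_add J2 J3, I1]
  refine setIntegral_congr_fun measurableSet_Ioi fun x hx => ?_
  rw [Set.mem_Ioi] at hx
  simp only [smul_eq_mul, hg]
  rw [abs_of_pos (by positivity)]
  ring

/-- Subordination: the Laplace transform of the law of `1/G²` at `l²/2`. -/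
lemma integral_exp_neg_div_sq_gaussian {l : ℝ} (hl : 0 ≤ l) :
    ∫ x, Real.exp (-(l ^ 2 / (2 * x ^ 2))) ∂stdG = Real.exp (-l) := by
  rcases hl.eq_or_lt with rfl | hl
  · simp
  rw [ProbabilityTheory.integral_gaussianReal_eq_integral_smul one_ne_zero]
  have h := integral_comp_abs (f := fun x : ℝ =>
    ProbabilityTheory.gaussianPDFReal 0 1 x • Real.exp (-(l ^ 2 / (2 * x ^ 2))))
  simp only [sq_abs, ProbabilityTheory.gaussianPDFReal, sub_zero, NNReal.coe_one, mul_one,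
    smul_eq_mul] at h ⊢
  rw [h]
  have e : ∀ x ∈ Set.Ioi (0 : ℝ), (√(2 * Real.pi))⁻¹ * Real.exp (-x ^ 2 / 2) *
      Real.exp (-(l ^ 2 / (2 * x ^ 2))) =
      ((√(2 * Real.pi))⁻¹ * Real.exp (-l)) * Real.exp (-(x - l / x) ^ 2 / 2) := by
    intro x hx
    rw [Set.mem_Ioi] at hx
    rw [mul_assoc, mul_assoc, ← Real.exp_add, ← Real.exp_add]
    congr 2
    field_simp
    ring
  rw [setIntegral_congr_fun measurableSet_Ioi e, integral_const_mul]
  have := integral_exp_sub_div_sq hl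
  have hp : √(2 * Real.pi) ≠ 0 := by positivity
  rw [mul_left_comm, this]
  field_simp

lemma integral_exp_I_gaussian (a : ℝ) :
    ∫ x, Complex.exp (Complex.I * a * x) ∂stdG = Complex.exp (-(a ^ 2 / 2 : ℝ)) := by
  have h := ProbabilityTheory.complexMGF_gaussianReal (X := id) (p := stdG) (μ := 0) (v := 1)
    (by simp) (Complex.I * a)
  simp only [ProbabilityTheory.complexMGF, id] at h
  rw [h]
  congr 1
  push_cast
  rw [mul_pow, Complex.I_sq]; ring

lemma integral_mul_exp_I_gaussian (a : ℝ) :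
    ∫ x : ℝ, (x : ℂ) * Complex.exp (Complex.I * a * x) ∂stdG =
      Complex.I * a * Complex.exp (-(a ^ 2 / 2 : ℝ)) := by
  have h := ProbabilityTheory.hasDerivAt_complexMGF (X := id) (μ := stdG) (z := Complex.I * a)
    (by simp [ProbabilityTheory.integrableExpSet_id_gaussianReal])
  have h2 : ProbabilityTheory.complexMGF id stdG = fun z => Complex.exp (z ^ 2 / 2) := by
    ext z
    rw [ProbabilityTheory.complexMGF_gaussianReal (X := id) (p := stdG) (μ := 0) (v := 1)
      (by simp)]
    simp
  rw [h2] at h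
  have h3 : HasDerivAt (fun z : ℂ => Complex.exp (z ^ 2 / 2))
      (Complex.exp ((Complex.I * a) ^ 2 / 2) * (Complex.I * a)) (Complex.I * a) := by
    have := (((hasDerivAt_id (Complex.I * (a : ℂ))).pow 2).div_const 2).cexp
    convert! this using 1
    simp
  have := h.unique h3
  simp only [id] at this
  rw [this, mul_comm]
  congr 2
  push_cast
  rw [mul_pow, Complex.I_sq]; ring

/-! ### The Poisson semigroup -/

lemma kAbs_eq (k : Fin 2 → ℤ) : kAbs k = √((k 0 : ℝ) ^ 2 + (k 1 : ℝ) ^ 2) := by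
  simp [kAbs, eNorm]

lemma kAbs_nonneg (k : Fin 2 → ℤ) : 0 ≤ kAbs k := Real.sqrt_nonneg _

lemma kAbs_sq (k : Fin 2 → ℤ) : kAbs k ^ 2 = (k 0 : ℝ) ^ 2 + (k 1 : ℝ) ^ 2 := by
  rw [kAbs_eq, Real.sq_sqrt (by positivity)]

lemma abs_le_kAbs (k : Fin 2 → ℤ) (i : Fin 2) : |(k i : ℝ)| ≤ kAbs k := by
  rw [kAbs_eq]
  apply Real.abs_le_sqrt
  fin_cases i <;> simp <;> positivity

lemma kAbs_eq_zero {k : Fin 2 → ℤ} (h : kAbs k = 0) : k = 0 := by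
  ext i
  have := abs_le_kAbs k i
  rw [h] at this
  simpa using this

/-- Symbol of the Poisson semigroup `e^{-tΛ}`. -/
def Psym (t : ℝ) (k : Fin 2 → ℤ) : ℂ := ((Real.exp (-(t * kAbs k)) : ℝ) : ℂ)

/-- Symbol of `∂_i`. -/
def Dsym (i : Fin 2) (k : Fin 2 → ℤ) : ℂ := Complex.I * (k i : ℂ)

lemma norm_Dsym_le (i : Fin 2) (k : Fin 2 → ℤ) : ‖Dsym i k‖ ≤ kAbs k := by
  simpa [Dsym] using abs_le_kAbs k i

lemma norm_Psym_le {t : ℝ} (ht : 0 ≤ t) (k : Fin 2 → ℤ) : ‖Psym t k‖ ≤ 1 := by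
  rw [Psym, Complex.norm_real, Real.norm_of_nonneg (Real.exp_pos _).le]
  exact Real.exp_le_one_iff.2 (by have := mul_nonneg ht (kAbs_nonneg k); linarith)

lemma Psym_half (t : ℝ) (k : Fin 2 → ℤ) : Psym (t / 2) k * Psym (t / 2) k = Psym t k := by
  rw [Psym, Psym, ← Complex.ofReal_mul, ← Real.exp_add]
  congr 3; ring

/-- The probability space carrying three independent standard Gaussians. -/
abbrev poiM : Measure (ℝ × ℝ × ℝ) := stdG.prod (stdG.prod stdG)

/-- A planar Cauchy random variable, of scale `t`. -/
def poiX (t : ℝ) (ω : ℝ × ℝ × ℝ) : Vd 2 := ![t * ω.2.1 / |ω.1|, t * ω.2.2 / |ω.1|]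

/-- The weight representing `∂_i e^{-tΛ}`. -/
def poiW (t : ℝ) (i : Fin 2) (ω : ℝ × ℝ × ℝ) : ℝ := t⁻¹ * |ω.1| * (![ω.2.1, ω.2.2] : Vd 2) i

lemma measurable_poiX (t : ℝ) : Measurable (poiX t) := by
  refine measurable_pi_iff.2 fun i => ?_
  fin_cases i <;> simp [poiX] <;> fun_prop

lemma tchar_poiX (k : Fin 2 → ℤ) (t r p q : ℝ) :
    tchar k (poiX t (r, p, q)) = Complex.exp (Complex.I * (t * k 0 / |r| : ℝ) * p) *
      Complex.exp (Complex.I * (t * k 1 / |r| : ℝ) * q) := by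
  rw [tchar, ← Complex.exp_add, dotZ_eq]
  congr 1
  simp [poiX]
  ring

lemma exp_mul_exp_poi (k : Fin 2 → ℤ) (t r : ℝ) :
    Complex.exp (-((t * k 0 / |r|) ^ 2 / 2 : ℝ)) * Complex.exp (-((t * k 1 / |r|) ^ 2 / 2 : ℝ)) =
      ((Real.exp (-((t * kAbs k) ^ 2 / (2 * r ^ 2))) : ℝ) : ℂ) := by
  rw [← Complex.exp_add, Complex.ofReal_exp]
  congr 1
  rw [mul_pow, kAbs_sq, div_pow, div_pow, sq_abs]
  push_cast
  field_simp
  ring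

lemma Psym_eq_integral {t : ℝ} (ht : 0 ≤ t) (k : Fin 2 → ℤ) :
    Psym t k = ∫ ω, 1 * tchar k (poiX t ω) ∂poiM := by
  simp only [one_mul]
  rw [integral_prod]
  · have : ∀ r : ℝ, ∫ y : ℝ × ℝ, tchar k (poiX t (r, y)) ∂(stdG.prod stdG) =
        ((Real.exp (-((t * kAbs k) ^ 2 / (2 * r ^ 2))) : ℝ) : ℂ) := by
      intro r
      have : ∀ y : ℝ × ℝ, tchar k (poiX t (r, y)) = _ := fun y => tchar_poiX k t r y.1 y.2
      simp only [this]
      rw [integral_prod_mul (fun p : ℝ => Complex.exp (Complex.I * (t * k 0 / |r| : ℝ) * p))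
        (fun q : ℝ => Complex.exp (Complex.I * (t * k 1 / |r| : ℝ) * q)),
        integral_exp_I_gaussian, integral_exp_I_gaussian, exp_mul_exp_poi]
    simp only [this]
    rw [integral_complex_ofReal, integral_exp_neg_div_sq_gaussian
      (mul_nonneg ht (kAbs_nonneg k)), Psym]
  · refine Integrable.of_bound ?_ 1 (.of_forall fun ω => (norm_tchar _ _).le)
    exact ((continuous_tchar k).measurable.comp (measurable_poiX t)).aestronglyMeasurable

lemma integrable_abs_stdG : Integrable (fun x : ℝ => |x|) stdG := by
  have := (ProbabilityTheory.memLp_id_gaussianReal (μ := 0) (v := 1) 1).integrable (by simp)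
  exact this.abs

lemma integrable_sq_stdG : Integrable (fun x : ℝ => x ^ 2) stdG :=
  (ProbabilityTheory.memLp_id_gaussianReal (μ := 0) (v := 1) 2).integrable_sq

/-- The integrand dominating the first moments of the Poisson gradient kernel. -/
def poiB (ω : ℝ × ℝ × ℝ) : ℝ := (|ω.2.1| + |ω.2.2|) * (|ω.1| + |ω.2.1| + |ω.2.2|)

lemma integrable_poiB : Integrable poiB poiM := by
  have hA := integrable_abs_stdG
  have hS := integrable_sq_stdG
  have h1 : Integrable (fun _ : ℝ => (1 : ℝ)) stdG := integrable_const _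
  have e : poiB = fun ω => |ω.1| * (|ω.2.1| * 1) + |ω.1| * (1 * |ω.2.2|) +
      1 * (ω.2.1 ^ 2 * 1) + 1 * (1 * ω.2.2 ^ 2) + 2 * (1 * (|ω.2.1| * |ω.2.2|)) := by
    ext ω
    rw [poiB, ← sq_abs ω.2.1, ← sq_abs ω.2.2]; ring
  rw [e]
  exact ((((hA.mul_prod (hA.mul_prod h1)).add (hA.mul_prod (h1.mul_prod hA))).add
    (h1.mul_prod (hS.mul_prod h1))).add (h1.mul_prod (h1.mul_prod hS))).add
    ((h1.mul_prod (hA.mul_prod hA)).const_mul 2)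

lemma abs_poiW_le {t : ℝ} (ht : 0 < t) (i : Fin 2) (ω : ℝ × ℝ × ℝ) :
    |poiW t i ω| ≤ t⁻¹ * (|ω.1| * (|ω.2.1| + |ω.2.2|)) := by
  rw [poiW, abs_mul, abs_mul, abs_abs, abs_of_pos (inv_pos.2 ht), mul_assoc]
  gcongr
  fin_cases i <;> simp

lemma measurable_poiW (t : ℝ) (i : Fin 2) : Measurable (poiW t i) := by
  unfold poiW
  fin_cases i <;> simp <;> fun_prop

lemma integrable_poiW {t : ℝ} (ht : 0 < t) (i : Fin 2) : Integrable (poiW t i) poiM := by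
  refine (integrable_poiB.const_mul t⁻¹).mono' (measurable_poiW t i).aestronglyMeasurable
    (.of_forall fun ω => (abs_poiW_le ht i ω).trans ?_)
  rw [poiB]
  refine mul_le_mul_of_nonneg_left ?_ (inv_nonneg.2 ht.le)
  nlinarith [abs_nonneg ω.1, abs_nonneg ω.2.1, abs_nonneg ω.2.2]

lemma Dsym_mul_Psym_eq_integral {t : ℝ} (ht : 0 < t) (i : Fin 2) (k : Fin 2 → ℤ) :
    Dsym i k * Psym t k = ∫ ω, (poiW t i ω : ℂ) * tchar k (poiX t ω) ∂poiM := by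
  rw [integral_prod]
  · have : ∀ r : ℝ, r ≠ 0 →
        ∫ y : ℝ × ℝ, (poiW t i (r, y) : ℂ) * tchar k (poiX t (r, y)) ∂(stdG.prod stdG) =
        Dsym i k * ((Real.exp (-((t * kAbs k) ^ 2 / (2 * r ^ 2))) : ℝ) : ℂ) := by
      intro r hr
      have hr' : ((|r| : ℝ) : ℂ) ≠ 0 := by simpa using hr
      have ht' : (t : ℂ) ≠ 0 := by exact_mod_cast ht.ne'
      rw [← exp_mul_exp_poi]
      have h0 : ∀ y : ℝ × ℝ, tchar k (poiX t (r, y)) = _ := fun y => tchar_poiX k t r y.1 y.2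
      simp only [h0]
      fin_cases i
      · have h1 : ∀ y : ℝ × ℝ, ((poiW t 0 (r, y) : ℝ) : ℂ) *
            (Complex.exp (Complex.I * (t * k 0 / |r| : ℝ) * y.1) *
            Complex.exp (Complex.I * (t * k 1 / |r| : ℝ) * y.2)) =
            ((t : ℂ)⁻¹ * |r|) * ((y.1 * Complex.exp (Complex.I * (t * k 0 / |r| : ℝ) * y.1)) *
            Complex.exp (Complex.I * (t * k 1 / |r| : ℝ) * y.2)) := by
          intro y; simp [poiW]; ring
        simp only [Fin.zero_eta, h1]
        rw [integral_const_mul, integral_prod_mul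
          (fun p : ℝ => p * Complex.exp (Complex.I * (t * k 0 / |r| : ℝ) * p))
          (fun q : ℝ => Complex.exp (Complex.I * (t * k 1 / |r| : ℝ) * q)),
          integral_mul_exp_I_gaussian, integral_exp_I_gaussian, ← mul_assoc, ← mul_assoc]
        rw [Dsym]
        have : ((t * k 0 / |r| : ℝ) : ℂ) = t * k 0 / (|r| : ℝ) := by push_cast; rfl
        rw [this]
        field_simp
      · have h1 : ∀ y : ℝ × ℝ, ((poiW t 1 (r, y) : ℝ) : ℂ) *
            (Complex.exp (Complex.I * (t * k 0 / |r| : ℝ) * y.1) *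
            Complex.exp (Complex.I * (t * k 1 / |r| : ℝ) * y.2)) =
            ((t : ℂ)⁻¹ * |r|) * (Complex.exp (Complex.I * (t * k 0 / |r| : ℝ) * y.1) *
            (y.2 * Complex.exp (Complex.I * (t * k 1 / |r| : ℝ) * y.2))) := by
          intro y; simp [poiW]; ring
        simp only [Fin.mk_one, h1]
        rw [integral_const_mul, integral_prod_mul
          (fun p : ℝ => Complex.exp (Complex.I * (t * k 0 / |r| : ℝ) * p))
          (fun q : ℝ => q * Complex.exp (Complex.I * (t * k 1 / |r| : ℝ) * q)),
          integral_mul_exp_I_gaussian, integral_exp_I_gaussian]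
        rw [Dsym]
        have : ((t * k 1 / |r| : ℝ) : ℂ) = t * k 1 / (|r| : ℝ) := by push_cast; rfl
        rw [this]
        field_simp
    have hae : ∀ᵐ r ∂stdG, r ≠ 0 := by
      have := ProbabilityTheory.nullSingletonClass_gaussianReal (μ := 0) (v := 1) one_ne_zero
      exact compl_mem_ae_iff.2 (measure_singleton (0 : ℝ))
    rw [integral_congr_ae (hae.mono this), integral_const_mul, integral_complex_ofReal,
      integral_exp_neg_div_sq_gaussian (mul_nonneg ht.le (kAbs_nonneg k)), Psym]
  · refine (integrable_poiW ht i).ofReal.mul_bdd (c := 1) ?_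
      (.of_forall fun ω => (norm_tchar _ _).le)
    exact ((continuous_tchar k).measurable.comp (measurable_poiX t)).aestronglyMeasurable

/-- The constant in the gradient bounds for the Poisson semigroup. -/
def poiC : ℝ := ∫ ω, poiB ω ∂poiM

lemma poiC_nonneg : 0 ≤ poiC :=
  integral_nonneg fun ω => by unfold poiB; positivity

lemma abs_poiW_mul_rpow_le {t β : ℝ} (ht : 0 < t) (hβ0 : 0 ≤ β) (hβ1 : β ≤ 1) (i : Fin 2)
    (ω : ℝ × ℝ × ℝ) : |poiW t i ω| * ‖poiX t ω‖ ^ β ≤ t ^ (β - 1) * poiB ω := by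
  obtain ⟨r, p, q⟩ := ω
  rcases eq_or_ne r 0 with rfl | hr
  · have : 0 ≤ poiB (0, p, q) := by unfold poiB; positivity
    have h2 : 0 ≤ t ^ (β - 1) := by positivity
    simpa [poiW] using mul_nonneg h2 this
  have hr' : 0 < |r| := abs_pos.2 hr
  have hX : ‖poiX t (r, p, q)‖ ≤ t * ((|p| + |q|) / |r|) := by
    refine (pi_norm_le_iff_of_nonneg (by positivity)).2 fun j => ?_
    rw [← mul_div_assoc]
    fin_cases j
    · simp only [poiX]
      simp [abs_of_pos ht]
      gcongr; linarith [abs_nonneg q]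
    · simp only [poiX]
      simp [abs_of_pos ht]
      gcongr; linarith [abs_nonneg p]
  have hpow : ∀ s : ℝ, 0 ≤ s → s ^ β ≤ 1 + s := by
    intro s hs
    rcases le_total s 1 with h | h
    · exact (Real.rpow_le_one hs h hβ0).trans (by linarith)
    · exact (Real.rpow_le_rpow_of_exponent_le h hβ1).trans (by rw [Real.rpow_one]; linarith)
  calc |poiW t i (r, p, q)| * ‖poiX t (r, p, q)‖ ^ β
      ≤ (t⁻¹ * (|r| * (|p| + |q|))) * (t ^ β * (1 + (|p| + |q|) / |r|)) := by
        gcongr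
        · exact abs_poiW_le ht i _
        · refine (Real.rpow_le_rpow (norm_nonneg _) hX hβ0).trans ?_
          rw [Real.mul_rpow ht.le (by positivity)]
          gcongr
          exact hpow _ (by positivity)
    _ = t ^ (β - 1) * poiB (r, p, q) := by
        rw [Real.rpow_sub_one ht.ne', poiB]
        field_simp
        ring

lemma continuous_trig {ι : Type*} {κ : ι → Fin 2 → ℤ} {c : ι → ℂ}
    (hc : Summable fun j => ‖c j‖) : Continuous (trig κ c) := by
  refine continuous_tsum (fun j => by fun_prop) hc fun j x => ?_
  simp [norm_tchar]

section PoissonBounds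

variable {ι : Type*} [Countable ι] {κ : ι → Fin 2 → ℤ} {c : ι → ℂ}

lemma norm_trig_Psym_le {t A : ℝ} (ht : 0 ≤ t) (hc : Summable fun j => ‖c j‖)
    (h : ∀ x, ‖trig κ c x‖ ≤ A) (x : Vd 2) :
    ‖trig κ (fun j => Psym t (κ j) * c j) x‖ ≤ A := by
  rw [trig_mul_eq_integral (measurable_poiX t) (integrable_const (1 : ℂ)) (Psym_eq_integral ht) hc]
  refine (norm_integral_le_of_norm_le_const (C := A) (.of_forall fun ω => ?_)).trans ?_
  · simpa using h _
  · simp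

lemma norm_trig_Dsym_Psym_le {t A β : ℝ} (ht : 0 < t) (hβ0 : 0 ≤ β) (hβ1 : β ≤ 1)
    (hc : Summable fun j => ‖c j‖) (hA : 0 ≤ A)
    (h : ∀ x z, ‖trig κ c (x + z) - trig κ c x‖ ≤ A * ‖z‖ ^ β) (i : Fin 2) (x : Vd 2) :
    ‖trig κ (fun j => Dsym i (κ j) * Psym t (κ j) * c j) x‖ ≤ poiC * A * t ^ (β - 1) := by
  have hw : Integrable (fun ω => (poiW t i ω : ℂ)) poiM := (integrable_poiW ht i).ofReal
  rw [trig_mul_eq_integral (m := fun k => Dsym i k * Psym t k) (measurable_poiX t) hw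
    (Dsym_mul_Psym_eq_integral ht i) hc]
  have h0 : ∫ ω, (poiW t i ω : ℂ) ∂poiM = 0 := by
    have := Dsym_mul_Psym_eq_integral ht i 0
    simpa [Dsym, tchar, dotZ_eq] using this.symm
  have hi : Integrable (fun ω => (poiW t i ω : ℂ) * trig κ c (x + poiX t ω)) poiM := by
    refine hw.mul_bdd (c := ∑' j, ‖c j‖) ?_ (.of_forall fun ω => ?_)
    · exact ((continuous_trig hc).measurable.comp
        ((measurable_poiX t).const_add x)).aestronglyMeasurable
    · refine (norm_tsum_le_tsum_norm ?_).trans_eq ?_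
      · simpa [norm_tchar] using hc
      · simp [norm_tchar]
  have e : ∫ ω, (poiW t i ω : ℂ) * trig κ c (x + poiX t ω) ∂poiM =
      ∫ ω, (poiW t i ω : ℂ) * (trig κ c (x + poiX t ω) - trig κ c x) ∂poiM := by
    simp only [mul_sub]
    rw [integral_sub hi (hw.mul_const _), integral_mul_const, h0]
    simp
  rw [e]
  refine (norm_integral_le_of_norm_le (integrable_poiB.const_mul (A * t ^ (β - 1)))
    (.of_forall fun ω => ?_)).trans_eq ?_
  · rw [norm_mul, Complex.norm_real, Real.norm_eq_abs]
    calc |poiW t i ω| * ‖trig κ c (x + poiX t ω) - trig κ c x‖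
        ≤ |poiW t i ω| * (A * ‖poiX t ω‖ ^ β) := by gcongr; exact h _ _
      _ = A * (|poiW t i ω| * ‖poiX t ω‖ ^ β) := by ring
      _ ≤ A * (t ^ (β - 1) * poiB ω) := by
        exact mul_le_mul_of_nonneg_left (abs_poiW_mul_rpow_le ht hβ0 hβ1 i ω) hA
      _ = _ := by ring
  · rw [integral_const_mul, poiC]; ring

end PoissonBounds

/-! ### Rapidly decreasing coefficients -/

/-- The coefficients `c` decrease faster than any power of the frequency. -/
def Rapid {ι : Type*} (κ : ι → Fin 2 → ℤ) (c : ι → ℂ) : Prop :=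
  ∀ n : ℕ, Summable fun j => (1 + ‖κ j‖) ^ n * ‖c j‖

section Rapid

variable {ι : Type*} {κ : ι → Fin 2 → ℤ} {c d : ι → ℂ}

lemma Rapid.summable (hc : Rapid κ c) : Summable fun j => ‖c j‖ := by
  simpa using hc 0

lemma Rapid.mul {m : ι → ℂ} {M : ℝ} {p : ℕ} (hc : Rapid κ c)
    (hm : ∀ j, ‖m j‖ ≤ M * (1 + ‖κ j‖) ^ p) : Rapid κ fun j => m j * c j := by
  intro n
  refine Summable.of_nonneg_of_le (fun j => by positivity) (fun j => ?_)
    ((hc (n + p)).mul_left M)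
  rw [norm_mul, pow_add]
  calc (1 + ‖κ j‖) ^ n * (‖m j‖ * ‖c j‖)
      ≤ (1 + ‖κ j‖) ^ n * ((M * (1 + ‖κ j‖) ^ p) * ‖c j‖) := by gcongr; exact hm j
    _ = _ := by ring

lemma Rapid.mul_bdd {m : ι → ℂ} {M : ℝ} (hc : Rapid κ c) (hm : ∀ j, ‖m j‖ ≤ M) :
    Rapid κ fun j => m j * c j :=
  hc.mul (M := M) (p := 0) (by simpa using hm)

lemma Rapid.const_mul (hc : Rapid κ c) (a : ℂ) : Rapid κ fun j => a * c j :=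
  hc.mul_bdd (m := fun _ => a) fun _ => le_rfl

lemma Rapid.add (hc : Rapid κ c) (hd : Rapid κ d) : Rapid κ fun j => c j + d j := by
  intro n
  refine Summable.of_nonneg_of_le (fun j => by positivity) (fun j => ?_) ((hc n).add (hd n))
  rw [← mul_add]
  gcongr
  exact norm_add_le _ _

lemma Rapid.sum {σ : Type*} (s : Finset σ) {d : σ → ι → ℂ} (hd : ∀ i ∈ s, Rapid κ (d i)) :
    Rapid κ fun j => ∑ i ∈ s, d i j := by
  intro n
  refine Summable.of_nonneg_of_le (fun j => by positivity) (fun j => ?_)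
    (summable_sum fun i hi => hd i hi n)
  rw [← Finset.mul_sum]
  gcongr
  exact norm_sum_le _ _

lemma norm_Dsym_le_norm (i : Fin 2) (k : Fin 2 → ℤ) : ‖Dsym i k‖ ≤ 1 * (1 + ‖k‖) ^ 1 := by
  have h : ‖k i‖ ≤ ‖k‖ := norm_le_pi_norm k i
  have h2 : ‖Dsym i k‖ = ‖k i‖ := by simp [Dsym, Int.norm_eq_abs]
  rw [h2]; linarith

lemma Rapid.Dsym (hc : Rapid κ c) (i : Fin 2) : Rapid κ fun j => Dsym i (κ j) * c j :=
  hc.mul fun j => norm_Dsym_le_norm i (κ j)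

lemma Rapid.Psym (hc : Rapid κ c) {t : ℝ} (ht : 0 ≤ t) : Rapid κ fun j => Psym t (κ j) * c j :=
  hc.mul_bdd fun j => norm_Psym_le ht (κ j)

lemma Rapid.tchar (hc : Rapid κ c) (v : Vd 2) : Rapid κ fun j => tchar (κ j) v * c j :=
  hc.mul_bdd fun j => (norm_tchar (κ j) v).le

lemma Rapid.diff (hc : Rapid κ c) (v : Vd 2) : Rapid κ fun j => (_root_.tchar (κ j) v - 1) * c j := by
  refine hc.mul_bdd (M := 2) fun j => (norm_sub_le _ _).trans ?_
  rw [norm_tchar, norm_one]; norm_num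

/-- The frequencies of a product of two trigonometric series. -/
def pairFreq {ι' : Type*} (κ : ι → Fin 2 → ℤ) (κ' : ι' → Fin 2 → ℤ) (p : ι × ι') :
    Fin 2 → ℤ := κ p.1 + κ' p.2

variable {ι' : Type*} {κ' : ι' → Fin 2 → ℤ} {b : ι' → ℂ}

lemma Rapid.pair (hc : Rapid κ c) (hb : Rapid κ' b) :
    Rapid (pairFreq κ κ') fun p => c p.1 * b p.2 := by
  intro n
  refine Summable.of_nonneg_of_le (fun j => by positivity) (fun p => ?_)
    ((hc n).mul_of_nonneg (hb n) (fun j => by positivity) (fun j => by positivity))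
  have h : 1 + ‖pairFreq κ κ' p‖ ≤ (1 + ‖κ p.1‖) * (1 + ‖κ' p.2‖) := by
    have := norm_add_le (κ p.1) (κ' p.2)
    have := mul_nonneg (norm_nonneg (κ p.1)) (norm_nonneg (κ' p.2))
    rw [pairFreq]; linarith
  calc (1 + ‖pairFreq κ κ' p‖) ^ n * ‖c p.1 * b p.2‖
      ≤ ((1 + ‖κ p.1‖) * (1 + ‖κ' p.2‖)) ^ n * ‖c p.1 * b p.2‖ := by gcongr
    _ = _ := by rw [norm_mul, mul_pow]; ring

lemma trig_pair (hc : Rapid κ c) (hb : Rapid κ' b) (x : Vd 2) :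
    trig (pairFreq κ κ') (fun p => c p.1 * b p.2) x = trig κ c x * trig κ' b x := by
  have h1 := hc.summable
  have h2 := hb.summable
  rw [trig, trig, trig, tsum_mul_tsum_of_summable_norm]
  · refine tsum_congr fun p => ?_
    rw [pairFreq, tchar_add_left]; ring
  · simpa [norm_tchar] using h1
  · simpa [norm_tchar] using h2

end Rapid

/-! ### Derivatives of trigonometric series -/

section Deriv

variable {ι : Type*} {κ : ι → Fin 2 → ℤ} {c : ι → ℂ}

/-- The `i`-th coordinate as a real-linear map into `ℂ`. -/
def coordC (i : Fin 2) : Vd 2 →L[ℝ] ℂ :=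
  Complex.ofRealCLM.comp (ContinuousLinearMap.proj (R := ℝ) (φ := fun _ : Fin 2 => ℝ) i)

lemma coordC_apply (i : Fin 2) (v : Vd 2) : coordC i v = (v i : ℂ) := rfl

lemma norm_coordC_le (i : Fin 2) : ‖coordC i‖ ≤ 1 := by
  refine ContinuousLinearMap.opNorm_le_bound _ zero_le_one fun v => ?_
  rw [coordC_apply, Complex.norm_real, one_mul]
  exact norm_le_pi_norm v i

lemma hasFDerivAt_tchar (k : Fin 2 → ℤ) (x : Vd 2) :
    HasFDerivAt (tchar k) (∑ i, (Dsym i k * tchar k x) • coordC i) x := by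
  have h : HasFDerivAt (fun y : Vd 2 => Complex.I * (dotZ k y : ℂ))
      (∑ i, Dsym i k • coordC i) x := by
    have e : (fun y : Vd 2 => Complex.I * (dotZ k y : ℂ)) =
        fun y => (∑ i, Dsym i k • coordC i) y := by
      ext y
      simp [dotZ_eq, Dsym, coordC_apply]; ring
    rw [e]
    exact ContinuousLinearMap.hasFDerivAt _
  have h2 := h.cexp
  refine h2.congr_fderiv ?_
  rw [Finset.smul_sum]
  refine Finset.sum_congr rfl fun i _ => ?_
  rw [smul_smul, mul_comm, tchar]

lemma hasFDerivAt_trig (hc : Rapid κ c) (x : Vd 2) :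
    HasFDerivAt (trig κ c) (∑ i, trig κ (fun j => Dsym i (κ j) * c j) x • coordC i) x := by
  have hs : ∀ i, Summable fun j => (Dsym i (κ j) * c j * tchar (κ j) x) • coordC i := by
    intro i
    exact (summable_trig (hc.Dsym i).summable x).smul_const _
  have e : ∑ i, trig κ (fun j => Dsym i (κ j) * c j) x • coordC i =
      ∑' j, ∑ i, (Dsym i (κ j) * c j * tchar (κ j) x) • coordC i := by
    rw [Summable.tsum_finsetSum fun i _ => hs i]
    refine Finset.sum_congr rfl fun i _ => ?_
    rw [trig, (summable_trig (hc.Dsym i).summable x).tsum_smul_const]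
  rw [e]
  refine hasFDerivAt_tsum (u := fun j => ∑ i, ‖Dsym i (κ j) * c j‖)
    (f := fun j y => c j * tchar (κ j) y)
    (f' := fun j y => ∑ i, (Dsym i (κ j) * c j * tchar (κ j) y) • coordC i) (x₀ := x)
    (summable_sum fun i _ => (hc.Dsym i).summable) (fun j y => ?_) (fun j y => ?_)
    (summable_trig hc.summable x) x
  · refine ((hasFDerivAt_tchar (κ j) y).const_mul (c j)).congr_fderiv ?_
    rw [Finset.smul_sum]
    refine Finset.sum_congr rfl fun i _ => ?_
    rw [smul_smul]; ring_nf
  · refine (norm_sum_le _ _).trans (Finset.sum_le_sum fun i _ => ?_)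
    rw [norm_smul, norm_mul _ (tchar _ _), norm_tchar, mul_one]
    exact mul_le_of_le_one_right (norm_nonneg _) (norm_coordC_le i)

lemma norm_trig_diff_le (hc : Rapid κ c) {M : ℝ}
    (hM : ∀ i x, ‖trig κ (fun j => Dsym i (κ j) * c j) x‖ ≤ M) (x v : Vd 2) :
    ‖trig κ c (x + v) - trig κ c x‖ ≤ 2 * M * ‖v‖ := by
  have := convex_univ.norm_image_sub_le_of_norm_hasFDerivWithin_le (𝕜 := ℝ) (C := 2 * M)
    (fun y _ => (hasFDerivAt_trig hc y).hasFDerivWithinAt) (fun y _ => ?_)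
    (Set.mem_univ x) (Set.mem_univ (x + v))
  · simpa using this
  · refine (norm_sum_le _ _).trans ?_
    calc _ ≤ ∑ _i : Fin 2, M := by
          refine Finset.sum_le_sum fun i _ => ?_
          rw [norm_smul]
          exact (mul_le_of_le_one_right (norm_nonneg _) (norm_coordC_le i)).trans (hM i y)
      _ = 2 * M := by simp

lemma trig_add_latt (x : Vd 2) (m : Fin 2 → ℤ) : trig κ c (x + latt m) = trig κ c x := by
  unfold trig
  refine tsum_congr fun j => ?_
  rw [tchar_add, tchar_latt, mul_one]

lemma exists_latt_near (v : Vd 2) : ∃ m : Fin 2 → ℤ, ‖v - latt m‖ ≤ 2 * Real.pi := by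
  refine ⟨fun i => ⌊v i / (2 * Real.pi)⌋, ?_⟩
  have hp : 0 < 2 * Real.pi := by positivity
  refine (pi_norm_le_iff_of_nonneg hp.le).2 fun i => ?_
  have h1 := Int.floor_le (v i / (2 * Real.pi))
  have h2 := Int.lt_floor_add_one (v i / (2 * Real.pi))
  rw [le_div_iff₀ hp] at h1
  rw [div_lt_iff₀ hp] at h2
  simp only [Pi.sub_apply, latt, Real.norm_eq_abs, abs_le]
  constructor <;> nlinarith

lemma norm_trig_osc_le (hc : Rapid κ c) {M : ℝ}
    (hM : ∀ i x, ‖trig κ (fun j => Dsym i (κ j) * c j) x‖ ≤ M) (x v : Vd 2) :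
    ‖trig κ c (x + v) - trig κ c x‖ ≤ 16 * M := by
  obtain ⟨m, hm⟩ := exists_latt_near v
  have h0 : 0 ≤ M := (norm_nonneg _).trans (hM 0 0)
  have e : trig κ c (x + v) = trig κ c (x + (v - latt m)) := by
    rw [← trig_add_latt (x + (v - latt m)) m]; congr 1; abel
  rw [e]
  refine (norm_trig_diff_le hc hM _ _).trans ?_
  have := Real.pi_le_four
  nlinarith

end Deriv

/-! ### Hölder bounds and the Poisson semigroup -/

/-- `A` bounds the `C^α` norm of a trigonometric series. -/
def HB {ι : Type*} (α : ℝ) (κ : ι → Fin 2 → ℤ) (c : ι → ℂ) (A : ℝ) : Prop :=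
  (∀ x, ‖trig κ c x‖ ≤ A) ∧ ∀ x v, ‖trig κ c (x + v) - trig κ c x‖ ≤ A * ‖v‖ ^ α

/-- Constant for the decay of derivatives of Poisson extensions. -/
def poiK : ℝ := 1 + 2 * poiC + 128 * poiC ^ 2

section PoissonDecay

variable {ι : Type*} {κ : ι → Fin 2 → ℤ} {c : ι → ℂ} {α A t : ℝ}

lemma HB.nonneg (h : HB α κ c A) : 0 ≤ A := (norm_nonneg _).trans (h.1 0)

lemma poiK_pos : 0 < poiK := by
  have := poiC_nonneg
  unfold poiK; positivity

variable [Countable ι]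

lemma norm_trig_DP_le_inv (ht : 0 < t) (hc : Rapid κ c) (h : ∀ x, ‖trig κ c x‖ ≤ A)
    (i : Fin 2) (x : Vd 2) :
    ‖trig κ (fun j => Dsym i (κ j) * Psym t (κ j) * c j) x‖ ≤ 2 * poiC * A * t⁻¹ := by
  have hA : 0 ≤ A := (norm_nonneg _).trans (h 0)
  have := norm_trig_Dsym_Psym_le (A := 2 * A) (β := 0) ht le_rfl zero_le_one hc.summable
    (by positivity) (fun x z => by
      rw [Real.rpow_zero, mul_one]
      exact (norm_sub_le _ _).trans (by linarith [h (x + z), h x])) i x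
  rw [zero_sub, Real.rpow_neg_one] at this
  linarith

lemma HB.norm_DP_le (ht : 0 < t) (hα0 : 0 < α) (hα1 : α < 1) (hc : Rapid κ c) (h : HB α κ c A)
    (i : Fin 2) (x : Vd 2) :
    ‖trig κ (fun j => Dsym i (κ j) * Psym t (κ j) * c j) x‖ ≤ poiC * A * t ^ (α - 1) :=
  norm_trig_Dsym_Psym_le ht hα0.le hα1.le hc.summable h.nonneg h.2 i x

lemma norm_trig_DP_le_inv_sq (ht : 0 < t) (hc : Rapid κ c) (h : ∀ x, ‖trig κ c x‖ ≤ A)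
    (i : Fin 2) (x : Vd 2) :
    ‖trig κ (fun j => Dsym i (κ j) * Psym t (κ j) * c j) x‖
      ≤ 128 * poiC ^ 2 * A * t ^ (-2 : ℝ) := by
  have hA : 0 ≤ A := (norm_nonneg _).trans (h 0)
  have hC := poiC_nonneg
  have ht2 : 0 < t / 2 := by positivity
  have h1 : ∀ i x, ‖trig κ (fun j => Dsym i (κ j) * (Psym (t / 2) (κ j) * c j)) x‖
      ≤ 2 * poiC * A * (t / 2)⁻¹ := by
    intro i x
    simpa only [mul_assoc] using norm_trig_DP_le_inv ht2 hc h i x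
  have h2 := norm_trig_osc_le (hc.Psym ht2.le) h1
  have h3 := norm_trig_Dsym_Psym_le (β := 0) ht2 le_rfl zero_le_one (hc.Psym ht2.le).summable
    (A := 16 * (2 * poiC * A * (t / 2)⁻¹)) (by positivity) (by simpa using h2) i x
  have e : (fun j => Dsym i (κ j) * Psym (t / 2) (κ j) * (Psym (t / 2) (κ j) * c j)) =
      fun j => Dsym i (κ j) * Psym t (κ j) * c j := by
    ext j; rw [← Psym_half t]; ring
  rw [e] at h3
  refine h3.trans_eq ?_
  rw [zero_sub, Real.rpow_neg_one, Real.rpow_neg ht.le, Real.rpow_two]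
  field_simp
  ring

lemma HB.norm_DDP_le (ht : 0 < t) (hα0 : 0 < α) (hα1 : α < 1) (hc : Rapid κ c) (h : HB α κ c A)
    (i i' : Fin 2) (x : Vd 2) :
    ‖trig κ (fun j => Dsym i' (κ j) * (Dsym i (κ j) * Psym t (κ j) * c j)) x‖
      ≤ 128 * poiC ^ 2 * A * t ^ (α - 2) := by
  have hA : 0 ≤ A := h.nonneg
  have hC := poiC_nonneg
  have ht2 : 0 < t / 2 := by positivity
  have hr : Rapid κ fun j => Dsym i (κ j) * Psym (t / 2) (κ j) * c j := by
    simpa only [mul_assoc] using (hc.Psym ht2.le).Dsym i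
  have h3 := norm_trig_DP_le_inv ht2 hr (h.norm_DP_le ht2 hα0 hα1 hc i) i' x
  have e : (fun j => Dsym i' (κ j) * Psym (t / 2) (κ j) *
      (Dsym i (κ j) * Psym (t / 2) (κ j) * c j)) =
      fun j => Dsym i' (κ j) * (Dsym i (κ j) * Psym t (κ j) * c j) := by
    ext j; rw [← Psym_half t]; ring
  rw [e] at h3
  refine h3.trans ?_
  have e2 : (t / 2) ^ (α - 1) * (t / 2)⁻¹ = t ^ (α - 2) * 2 ^ (2 - α) := by
    rw [← div_eq_mul_inv, ← Real.rpow_sub_one ht2.ne', Real.div_rpow ht.le zero_le_two, div_eq_mul_inv,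
      ← Real.rpow_neg zero_le_two]
    ring_nf
  have e3 : (2 : ℝ) ^ (2 - α) ≤ 4 := by
    calc (2 : ℝ) ^ (2 - α) ≤ 2 ^ (2 : ℝ) :=
          Real.rpow_le_rpow_of_exponent_le one_le_two (by linarith)
      _ = 4 := by norm_num
  have ht' : 0 ≤ t ^ (α - 2) := by positivity
  calc 2 * poiC * (poiC * A * (t / 2) ^ (α - 1)) * (t / 2)⁻¹
      = 2 * poiC ^ 2 * A * ((t / 2) ^ (α - 1) * (t / 2)⁻¹) := by ring
    _ = 2 * poiC ^ 2 * A * (t ^ (α - 2) * 2 ^ (2 - α)) := by rw [e2]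
    _ ≤ 2 * poiC ^ 2 * A * (t ^ (α - 2) * 4) := by gcongr
    _ ≤ 128 * poiC ^ 2 * A * t ^ (α - 2) := by
      nlinarith [mul_nonneg (mul_nonneg (sq_nonneg poiC) hA) ht']

/-- All the decay bounds for the Poisson extension of a Hölder function. -/
lemma HB.poisson_bounds (ht : 0 < t) (hα0 : 0 < α) (hα1 : α < 1) (hc : Rapid κ c)
    (h : HB α κ c A) :
    (∀ x, ‖trig κ (fun j => Psym t (κ j) * c j) x‖ ≤ poiK * A) ∧
    (∀ i x, ‖trig κ (fun j => Dsym i (κ j) * Psym t (κ j) * c j) x‖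
      ≤ poiK * A * t ^ (α - 1)) ∧
    (∀ i x, ‖trig κ (fun j => Dsym i (κ j) * Psym t (κ j) * c j) x‖ ≤ poiK * A * t⁻¹) ∧
    (∀ i x, ‖trig κ (fun j => Dsym i (κ j) * Psym t (κ j) * c j) x‖
      ≤ poiK * A * t ^ (-2 : ℝ)) ∧
    (∀ i i' x, ‖trig κ (fun j => Dsym i' (κ j) * (Dsym i (κ j) * Psym t (κ j) * c j)) x‖
      ≤ poiK * A * t ^ (α - 2)) := by
  have hA := h.nonneg
  have hC := poiC_nonneg
  have k0 : 1 ≤ poiK := by unfold poiK; nlinarith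
  have k1 : poiC ≤ poiK := by unfold poiK; nlinarith
  have k2 : 2 * poiC ≤ poiK := by unfold poiK; nlinarith
  have k3 : 128 * poiC ^ 2 ≤ poiK := by unfold poiK; nlinarith
  refine ⟨fun x => ?_, fun i x => ?_, fun i x => ?_, fun i x => ?_, fun i i' x => ?_⟩
  · exact (norm_trig_Psym_le ht.le hc.summable h.1 x).trans (le_mul_of_one_le_left hA k0)
  · exact (h.norm_DP_le ht hα0 hα1 hc i x).trans (by gcongr)
  · exact (norm_trig_DP_le_inv ht hc h.1 i x).trans (by gcongr)
  · exact (norm_trig_DP_le_inv_sq ht hc h.1 i x).trans (by gcongr)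
  · exact (h.norm_DDP_le ht hα0 hα1 hc i i' x).trans (by gcongr)

end PoissonDecay

/-! ### Singular integrals as integrals along the Poisson semigroup -/

lemma norm_integral_Ioi_le_of_rpow {h : ℝ → ℂ} {a b p q δ : ℝ} (hδ : 0 < δ) (hp : -1 < p)
    (hq : q < -1) (ha : ∀ t, 0 < t → ‖h t‖ ≤ a * t ^ p) (hb : ∀ t, 0 < t → ‖h t‖ ≤ b * t ^ q) :
    ‖∫ t in Set.Ioi (0 : ℝ), h t‖
      ≤ a * (δ ^ (p + 1) / (p + 1)) + b * (-δ ^ (q + 1) / (q + 1)) := by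
  have i1 : ∫ t in Set.Ioc 0 δ, a * t ^ p = a * (δ ^ (p + 1) / (p + 1)) := by
    rw [← intervalIntegral.integral_of_le hδ.le, intervalIntegral.integral_const_mul,
      integral_rpow (Or.inl hp), Real.zero_rpow (by linarith), sub_zero]
  have i2 : ∫ t in Set.Ioi δ, b * t ^ q = b * (-δ ^ (q + 1) / (q + 1)) := by
    rw [integral_const_mul, integral_Ioi_rpow_of_lt hq hδ]
  have j1 : IntegrableOn (fun t => a * t ^ p) (Set.Ioc 0 δ) :=
    ((intervalIntegrable_iff_integrableOn_Ioc_of_le hδ.le).1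
      (intervalIntegral.intervalIntegrable_rpow' hp)).const_mul a
  have j2 : IntegrableOn (fun t => b * t ^ q) (Set.Ioi δ) :=
    (integrableOn_Ioi_rpow_of_lt hq hδ).const_mul b
  have n1 : ‖∫ t in Set.Ioc 0 δ, h t‖ ≤ a * (δ ^ (p + 1) / (p + 1)) := by
    rw [← i1]
    exact norm_integral_le_of_norm_le j1
      ((ae_restrict_mem measurableSet_Ioc).mono fun t ht => ha t ht.1)
  have n2 : ‖∫ t in Set.Ioi δ, h t‖ ≤ b * (-δ ^ (q + 1) / (q + 1)) := by
    rw [← i2]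
    exact norm_integral_le_of_norm_le j2
      ((ae_restrict_mem measurableSet_Ioi).mono fun t ht => hb t (hδ.trans ht))
  by_cases hi : IntegrableOn h (Set.Ioi 0)
  · rw [← Set.Ioc_union_Ioi_eq_Ioi hδ.le, setIntegral_union (Set.Ioc_disjoint_Ioi le_rfl)
      measurableSet_Ioi (hi.mono_set Set.Ioc_subset_Ioi_self)
      (hi.mono_set (Set.Ioi_subset_Ioi hδ.le))]
    exact (norm_add_le _ _).trans (add_le_add n1 n2)
  · rw [integral_undef hi, norm_zero]
    exact add_nonneg ((norm_nonneg _).trans n1) ((norm_nonneg _).trans n2)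

section SingularIntegral

variable {ι : Type*} {κ : ι → Fin 2 → ℤ}

lemma integral_exp_neg_mul_Ioi {ρ : ℝ} (hρ : 0 < ρ) :
    ∫ t in Set.Ioi (0 : ℝ), Real.exp (-(t * ρ)) = ρ⁻¹ := by
  have := integral_exp_mul_Ioi (a := -ρ) (by linarith) 0
  simp only [mul_zero, Real.exp_zero] at this
  rw [show (fun t => Real.exp (-(t * ρ))) = fun t => Real.exp (-ρ * t) by ext; ring_nf, this]
  rw [neg_div_neg_eq, one_div]

lemma trig_div_eq_integral [Countable ι] {d : ι → ℂ} {ρ : ι → ℝ} (hρ : ∀ j, 0 ≤ ρ j)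
    (hd : ∀ j, ρ j = 0 → d j = 0) (hs : Summable fun j => ‖d j / ρ j‖) (x : Vd 2) :
    trig κ (fun j => d j / ρ j) x =
      ∫ t in Set.Ioi (0 : ℝ), trig κ (fun j => (Real.exp (-(t * ρ j)) : ℂ) * d j) x := by
  have hval : ∀ j, ∫ t in Set.Ioi (0 : ℝ), Real.exp (-(t * ρ j)) * ‖d j‖ = ‖d j / ρ j‖ := by
    intro j
    rcases (hρ j).eq_or_lt' with h | h
    · simp [hd j h]
    · rw [integral_mul_const, integral_exp_neg_mul_Ioi h, norm_div, Complex.norm_real,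
        Real.norm_of_nonneg h.le]
      ring
  have key := integral_tsum_of_summable_integral_norm (μ := volume.restrict (Set.Ioi (0 : ℝ)))
    (F := fun j t => (Real.exp (-(t * ρ j)) : ℂ) * d j * tchar (κ j) x) (fun j => ?_) ?_
  · unfold trig
    rw [← key]
    refine tsum_congr fun j => ?_
    simp only [mul_assoc]
    rw [integral_mul_const, integral_complex_ofReal]
    rcases (hρ j).eq_or_lt' with h | h
    · simp [hd j h]
    · rw [integral_exp_neg_mul_Ioi h]
      push_cast; ring
  · rcases (hρ j).eq_or_lt' with h | h
    · simp [hd j h]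
    · simp only [mul_assoc]
      refine Integrable.mul_const (Integrable.ofReal (𝕜 := ℂ) ?_) _
      have := integrableOn_exp_mul_Ioi (a := -ρ j) (by linarith) 0
      rwa [show (fun t => Real.exp (-ρ j * t)) = fun t => Real.exp (-(t * ρ j)) by
        ext; ring_nf] at this
  · convert hs using 2 with j
    rw [← hval j]
    refine integral_congr_ae (.of_forall fun t => ?_)
    simp only [norm_mul, norm_tchar, mul_one, Complex.norm_real,
      Real.norm_of_nonneg (Real.exp_pos _).le]

/-- Constant of the singular integral estimate. -/
def czC (α : ℝ) : ℝ := 1 + 2 * α⁻¹ + 2 * (1 - α)⁻¹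

lemma HB.of_integral [Countable ι] {d : ι → ℂ} {ρ : ι → ℝ} {α A : ℝ} (hα0 : 0 < α) (hα1 : α < 1)
    (hA : 0 ≤ A) (hρ : ∀ j, 0 ≤ ρ j) (hd : ∀ j, ρ j = 0 → d j = 0)
    (hs : Summable fun j => ‖d j / ρ j‖) (hr : Rapid κ d)
    (h1 : ∀ t, 0 < t → ∀ x, ‖trig κ (fun j => (Real.exp (-(t * ρ j)) : ℂ) * d j) x‖
      ≤ A * t ^ (α - 1))
    (h2 : ∀ t, 0 < t → ∀ x, ‖trig κ (fun j => (Real.exp (-(t * ρ j)) : ℂ) * d j) x‖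
      ≤ A * t ^ (-2 : ℝ))
    (h3 : ∀ t, 0 < t → ∀ i x,
      ‖trig κ (fun j => Dsym i (κ j) * ((Real.exp (-(t * ρ j)) : ℂ) * d j)) x‖
      ≤ A * t ^ (α - 2)) :
    HB α κ (fun j => d j / ρ j) (czC α * A) := by
  have ha : 0 < α⁻¹ := by positivity
  have hb : 0 < (1 - α)⁻¹ := inv_pos.2 (by linarith)
  have hexp : ∀ t, 0 < t → ∀ j, ‖(Real.exp (-(t * ρ j)) : ℂ)‖ ≤ 1 := by
    intro t ht j
    rw [Complex.norm_real, Real.norm_of_nonneg (Real.exp_pos _).le, Real.exp_le_one_iff]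
    have := mul_nonneg ht.le (hρ j)
    linarith
  have hrt : ∀ t, 0 < t → Rapid κ fun j => (Real.exp (-(t * ρ j)) : ℂ) * d j :=
    fun t ht => hr.mul_bdd (hexp t ht)
  constructor
  · intro x
    rw [trig_div_eq_integral hρ hd hs]
    refine (norm_integral_Ioi_le_of_rpow zero_lt_one (p := α - 1) (q := -2) (by linarith)
      (by norm_num) (fun t ht => h1 t ht x) (fun t ht => h2 t ht x)).trans ?_
    rw [Real.one_rpow, Real.one_rpow, sub_add_cancel, one_div, czC]
    norm_num
    nlinarith [mul_nonneg hA ha.le, mul_nonneg hA hb.le]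
  · intro x v
    rcases eq_or_ne v 0 with rfl | hv
    · simp [Real.zero_rpow hα0.ne']
    have hv' : 0 < ‖v‖ := norm_pos_iff.2 hv
    have hs' : Summable fun j => ‖(tchar (κ j) v - 1) * d j / ρ j‖ := by
      simp only [mul_div_assoc]
      exact summable_diff hs v
    have e := trig_div_eq_integral (κ := κ) hρ (fun j hj => by rw [hd j hj, mul_zero]) hs' x
    have e1 : trig κ (fun j => (tchar (κ j) v - 1) * d j / ρ j) x =
        trig κ (fun j => d j / ρ j) (x + v) - trig κ (fun j => d j / ρ j) x := by
      rw [← trig_diff hs]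
      simp only [mul_div_assoc]
    have e2 : ∀ t, 0 < t →
        trig κ (fun j => (Real.exp (-(t * ρ j)) : ℂ) * ((tchar (κ j) v - 1) * d j)) x =
        trig κ (fun j => (Real.exp (-(t * ρ j)) : ℂ) * d j) (x + v) -
        trig κ (fun j => (Real.exp (-(t * ρ j)) : ℂ) * d j) x := by
      intro t ht
      rw [← trig_diff (hrt t ht).summable]
      refine tsum_congr fun j => ?_
      ring
    rw [← e1, e]
    refine (norm_integral_Ioi_le_of_rpow (δ := ‖v‖) (a := 2 * A) (b := 2 * A * ‖v‖) hv'
      (p := α - 1) (q := α - 2) (by linarith) (by linarith) (fun t ht => ?_)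
      (fun t ht => ?_)).trans_eq ?_ |>.trans (mul_le_mul_of_nonneg_right
        (mul_le_mul_of_nonneg_right (?_ : 2 * α⁻¹ + 2 * (1 - α)⁻¹ ≤ _) hA) (by positivity))
    · rw [e2 t ht]
      refine (norm_sub_le _ _).trans ?_
      linarith [h1 t ht x, h1 t ht (x + v)]
    · rw [e2 t ht]
      refine (norm_trig_diff_le (hrt t ht) (h3 t ht) x v).trans_eq (by ring)
    · rw [sub_add_cancel, show α - 2 + 1 = α - 1 by ring, Real.rpow_sub_one hv'.ne']
      have : α - 1 ≠ 0 := by linarith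
      have : 1 - α ≠ 0 := by linarith
      rw [show α - 1 = -(1 - α) by ring]
      field_simp
    · rw [czC]; linarith

lemma czC_pos {α : ℝ} (hα0 : 0 < α) (hα1 : α < 1) : 0 < czC α := by
  have : 0 < (1 - α)⁻¹ := inv_pos.2 (by linarith)
  unfold czC; positivity

lemma norm_Rsym_le (i : Fin 2) (k : Fin 2 → ℤ) : ‖Dsym i k / kAbs k‖ ≤ 1 := by
  rw [norm_div, Complex.norm_real, Real.norm_of_nonneg (kAbs_nonneg k)]
  exact div_le_one_of_le₀ (norm_Dsym_le i k) (kAbs_nonneg k)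

/-- Riesz transforms are bounded on Hölder spaces. -/
lemma HB.riesz [Countable ι] {c : ι → ℂ} {α A : ℝ} (hα0 : 0 < α) (hα1 : α < 1) (hc : Rapid κ c)
    (h : HB α κ c A) (i : Fin 2) :
    HB α κ (fun j => Dsym i (κ j) / kAbs (κ j) * c j) (czC α * (poiK * A)) := by
  have e : ∀ j, Dsym i (κ j) / kAbs (κ j) * c j = Dsym i (κ j) * c j / kAbs (κ j) :=
    fun j => by ring
  have hrw : ∀ (t : ℝ) j, (Real.exp (-(t * kAbs (κ j))) : ℂ) * (Dsym i (κ j) * c j) =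
      Dsym i (κ j) * Psym t (κ j) * c j := by
    intro t j; rw [Psym]; ring
  simp only [e]
  refine HB.of_integral hα0 hα1 (mul_nonneg poiK_pos.le h.nonneg) (fun j => kAbs_nonneg _)
    (fun j hj => by simp [Dsym, kAbs_eq_zero hj]) ?_ (hc.Dsym i) (fun t ht x => ?_)
    (fun t ht x => ?_) (fun t ht i' x => ?_)
  · simp only [← e]
    exact summable_norm_mul (fun j => norm_Rsym_le i (κ j)) hc.summable
  · simp only [hrw]; exact (h.poisson_bounds ht hα0 hα1 hc).2.1 i x
  · simp only [hrw]; exact (h.poisson_bounds ht hα0 hα1 hc).2.2.2.1 i x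
  · simp only [hrw]; exact (h.poisson_bounds ht hα0 hα1 hc).2.2.2.2 i i' x

variable {ι' : Type*} {κ' : ι' → Fin 2 → ℤ}

lemma Dsym_add (i : Fin 2) (k l : Fin 2 → ℤ) : Dsym i (k + l) = Dsym i k + Dsym i l := by
  simp [Dsym]; ring

lemma norm_Bsym_le (i : Fin 2) (k l : Fin 2 → ℤ) :
    ‖(Dsym i k - Dsym i l) / ((kAbs k + kAbs l : ℝ) : ℂ)‖ ≤ 1 := by
  have h := add_nonneg (kAbs_nonneg k) (kAbs_nonneg l)
  rw [norm_div, Complex.norm_real, Real.norm_of_nonneg h]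
  refine div_le_one_of_le₀ ((norm_sub_le _ _).trans ?_) h
  exact add_le_add (norm_Dsym_le i k) (norm_Dsym_le i l)

/-- The bilinear operator with symbol `i (k_i - l_i) / (|k| + |l|)` is bounded on Hölder
spaces. -/
lemma HB.bilinear [Countable ι] [Countable ι'] {a : ι → ℂ} {b : ι' → ℂ} {α A B : ℝ}
    (hα0 : 0 < α) (hα1 : α < 1) (ha : Rapid κ a) (hb : Rapid κ' b)
    (hA : HB α κ a A) (hB : HB α κ' b B) (i : Fin 2) :
    HB α (pairFreq κ κ') (fun p => (Dsym i (κ p.1) - Dsym i (κ' p.2)) /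
      ((kAbs (κ p.1) + kAbs (κ' p.2) : ℝ) : ℂ) * (a p.1 * b p.2))
      (czC α * (4 * (poiK * A) * (poiK * B))) := by
  have hA0 := mul_nonneg poiK_pos.le hA.nonneg
  have hB0 := mul_nonneg poiK_pos.le hB.nonneg
  have e : ∀ p : ι × ι', (Dsym i (κ p.1) - Dsym i (κ' p.2)) /
      ((kAbs (κ p.1) + kAbs (κ' p.2) : ℝ) : ℂ) * (a p.1 * b p.2) =
      (Dsym i (κ p.1) - Dsym i (κ' p.2)) * (a p.1 * b p.2) /
      ((kAbs (κ p.1) + kAbs (κ' p.2) : ℝ) : ℂ) := fun p => by ring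
  have hexp : ∀ t k l, (Real.exp (-(t * (kAbs k + kAbs l))) : ℂ) = Psym t k * Psym t l := by
    intro t k l
    rw [Psym, Psym, ← Complex.ofReal_mul, ← Real.exp_add]
    congr 3; ring
  have hDPa : ∀ t, 0 < t → ∀ i, Rapid κ fun j => Dsym i (κ j) * Psym t (κ j) * a j := by
    intro t ht i
    simpa only [mul_assoc] using (ha.Psym ht.le).Dsym i
  have hDPb : ∀ t, 0 < t → ∀ i, Rapid κ' fun j => Dsym i (κ' j) * Psym t (κ' j) * b j := by
    intro t ht i
    simpa only [mul_assoc] using (hb.Psym ht.le).Dsym i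
  have hh : ∀ t, 0 < t → ∀ x, trig (pairFreq κ κ')
      (fun p => (Real.exp (-(t * (kAbs (κ p.1) + kAbs (κ' p.2)))) : ℂ) *
        ((Dsym i (κ p.1) - Dsym i (κ' p.2)) * (a p.1 * b p.2))) x =
      trig κ (fun j => Dsym i (κ j) * Psym t (κ j) * a j) x *
        trig κ' (fun j => Psym t (κ' j) * b j) x +
      (-1) * (trig κ (fun j => Psym t (κ j) * a j) x *
        trig κ' (fun j => Dsym i (κ' j) * Psym t (κ' j) * b j) x) := by
    intro t ht x
    rw [← trig_pair (hDPa t ht i) (hb.Psym ht.le), ← trig_pair (ha.Psym ht.le) (hDPb t ht i),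
      ← trig_const_mul, ← trig_add ((hDPa t ht i).pair (hb.Psym ht.le)).summable
        (((ha.Psym ht.le).pair (hDPb t ht i)).const_mul (-1)).summable]
    congr 1; ext p; rw [hexp]; ring
  have hr : Rapid (pairFreq κ κ') fun p : ι × ι' =>
      (Dsym i (κ p.1) - Dsym i (κ' p.2)) * (a p.1 * b p.2) := by
    convert ((ha.Dsym i).pair hb).add ((ha.pair (hb.Dsym i)).const_mul (-1)) using 2 with p
    ring
  have two : ∀ {u v w z : ℂ} {X : ℝ}, ‖u‖ * ‖v‖ ≤ X → ‖w‖ * ‖z‖ ≤ X →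
      ‖u * v + (-1) * (w * z)‖ ≤ 2 * X := by
    intro u v w z X h1 h2
    refine (norm_add_le _ _).trans ?_
    rw [norm_mul, norm_mul, norm_mul, norm_neg, norm_one]
    linarith
  simp only [e]
  refine HB.of_integral hα0 hα1 (by positivity)
    (fun p => add_nonneg (kAbs_nonneg _) (kAbs_nonneg _)) (fun p hp => ?_) ?_ hr
    (fun t ht x => ?_) (fun t ht x => ?_) (fun t ht i' x => ?_)
  · have h1 := kAbs_nonneg (κ p.1)
    have h2 := kAbs_nonneg (κ' p.2)
    rw [kAbs_eq_zero (k := κ p.1) (by linarith), kAbs_eq_zero (k := κ' p.2) (by linarith)]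
    simp
  · simp only [← e]
    exact summable_norm_mul (fun p => norm_Bsym_le i _ _) (ha.pair hb).summable
  · obtain ⟨a0, a1, -, -, -⟩ := hA.poisson_bounds ht hα0 hα1 ha
    obtain ⟨b0, b1, -, -, -⟩ := hB.poisson_bounds ht hα0 hα1 hb
    have := Real.rpow_nonneg ht.le (α - 1)
    rw [hh t ht]
    refine (two (mul_le_mul (a1 i x) (b0 x) (norm_nonneg _) (by positivity))
      ((mul_le_mul (a0 x) (b1 i x) (norm_nonneg _) (by positivity)).trans_eq (by ring))).trans ?_
    nlinarith [mul_nonneg (mul_nonneg hA0 hB0) this]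
  · obtain ⟨a0, -, -, a1, -⟩ := hA.poisson_bounds ht hα0 hα1 ha
    obtain ⟨b0, -, -, b1, -⟩ := hB.poisson_bounds ht hα0 hα1 hb
    have := Real.rpow_nonneg ht.le (-2)
    rw [hh t ht]
    refine (two (mul_le_mul (a1 i x) (b0 x) (norm_nonneg _) (by positivity))
      ((mul_le_mul (a0 x) (b1 i x) (norm_nonneg _) (by positivity)).trans_eq (by ring))).trans ?_
    nlinarith [mul_nonneg (mul_nonneg hA0 hB0) this]
  · obtain ⟨a0, a1, a2, -, a3⟩ := hA.poisson_bounds ht hα0 hα1 ha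
    obtain ⟨b0, b1, b2, -, b3⟩ := hB.poisson_bounds ht hα0 hα1 hb
    have hh' : trig (pairFreq κ κ') (fun p => Dsym i' (pairFreq κ κ' p) *
        ((Real.exp (-(t * (kAbs (κ p.1) + kAbs (κ' p.2)))) : ℂ) *
        ((Dsym i (κ p.1) - Dsym i (κ' p.2)) * (a p.1 * b p.2)))) x =
        (trig κ (fun j => Dsym i' (κ j) * (Dsym i (κ j) * Psym t (κ j) * a j)) x *
          trig κ' (fun j => Psym t (κ' j) * b j) x +
        (-1) * (trig κ (fun j => Psym t (κ j) * a j) x *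
          trig κ' (fun j => Dsym i' (κ' j) * (Dsym i (κ' j) * Psym t (κ' j) * b j)) x)) +
        (trig κ (fun j => Dsym i (κ j) * Psym t (κ j) * a j) x *
          trig κ' (fun j => Dsym i' (κ' j) * Psym t (κ' j) * b j) x +
        (-1) * (trig κ (fun j => Dsym i' (κ j) * Psym t (κ j) * a j) x *
          trig κ' (fun j => Dsym i (κ' j) * Psym t (κ' j) * b j) x)) := by
      have r1 := ((hDPa t ht i).Dsym i').pair (hb.Psym ht.le)
      have r2 := ((ha.Psym ht.le).pair ((hDPb t ht i).Dsym i')).const_mul (-1)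
      have r3 := (hDPa t ht i).pair (hDPb t ht i')
      have r4 := ((hDPa t ht i').pair (hDPb t ht i)).const_mul (-1)
      rw [← trig_pair ((hDPa t ht i).Dsym i') (hb.Psym ht.le),
        ← trig_pair (ha.Psym ht.le) ((hDPb t ht i).Dsym i'),
        ← trig_pair (hDPa t ht i) (hDPb t ht i'), ← trig_pair (hDPa t ht i') (hDPb t ht i),
        ← trig_const_mul, ← trig_const_mul, ← trig_add r1.summable r2.summable,
        ← trig_add r3.summable r4.summable, ← trig_add (r1.add r2).summable (r3.add r4).summable]
      congr 1; ext p; rw [hexp, pairFreq, Dsym_add]; ring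
    have e1 : t ^ (α - 1) * t⁻¹ = t ^ (α - 2) := by
      rw [← div_eq_mul_inv, ← Real.rpow_sub_one ht.ne']; ring_nf
    have hp := Real.rpow_nonneg ht.le (α - 2)
    have hp1 := Real.rpow_nonneg ht.le (α - 1)
    rw [hh']
    refine (norm_add_le _ _).trans ((add_le_add
      (two (X := poiK * A * (poiK * B) * t ^ (α - 2))
      ((mul_le_mul (a3 i i' x) (b0 x) (norm_nonneg _) (by positivity)).trans_eq (by ring))
      ((mul_le_mul (a0 x) (b3 i i' x) (norm_nonneg _) (by positivity)).trans_eq (by ring)))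
      (two (X := poiK * A * (poiK * B) * t ^ (α - 2))
      ((mul_le_mul (a1 i x) (b2 i' x) (norm_nonneg _) (by positivity)).trans_eq (by
        rw [← e1]; ring))
      ((mul_le_mul (a1 i' x) (b2 i x) (norm_nonneg _) (by positivity)).trans_eq (by
        rw [← e1]; ring)))).trans_eq (by ring))

end SingularIntegral

/-! ### The bilinear operator on coefficients -/

/-- Symbol of the bilinear operator `Λ⁻¹((Λf)g - f(Λg))`. -/
def Tsym (k l : Fin 2 → ℤ) : ℂ := (((kAbs k - kAbs l) / kAbs (k + l) : ℝ) : ℂ)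

lemma Tsym_eq (k l : Fin 2 → ℤ) :
    Tsym k l = (-1) * ∑ i, Dsym i (k + l) / kAbs (k + l) *
      ((Dsym i k - Dsym i l) / ((kAbs k + kAbs l : ℝ) : ℂ)) := by
  have h1 := kAbs_sq k
  have h2 := kAbs_sq l
  have e : ∑ i, Dsym i (k + l) * (Dsym i k - Dsym i l) =
      -(((kAbs k - kAbs l) * (kAbs k + kAbs l) : ℝ) : ℂ) := by
    have : (kAbs k - kAbs l) * (kAbs k + kAbs l) =
        (k 0 : ℝ) ^ 2 + (k 1 : ℝ) ^ 2 - ((l 0 : ℝ) ^ 2 + (l 1 : ℝ) ^ 2) := by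
      rw [← h1, ← h2]; ring
    rw [this]
    simp only [Dsym, Fin.sum_univ_two, Pi.add_apply]
    push_cast
    linear_combination ((k 0 + l 0 : ℂ) * (k 0 - l 0) + (k 1 + l 1) * (k 1 - l 1)) * Complex.I_sq
  simp only [div_mul_div_comm]
  rw [← Finset.sum_div, e, Tsym]
  rcases eq_or_ne (kAbs k + kAbs l) 0 with h | h
  · have h3 := kAbs_nonneg k
    have h4 := kAbs_nonneg l
    rw [show kAbs k = 0 by linarith, show kAbs l = 0 by linarith]
    simp
  · have h' : ((kAbs k + kAbs l : ℝ) : ℂ) ≠ 0 := by exact_mod_cast h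
    push_cast at h' ⊢
    rw [neg_div, neg_one_mul, neg_neg, mul_div_mul_right _ _ h']

lemma eNorm_eq_norm (x : Fin 2 → ℝ) : eNorm x = ‖WithLp.toLp 2 x‖ := by
  rw [EuclideanSpace.norm_eq]
  simp [eNorm]

lemma abs_kAbs_sub_le (k l : Fin 2 → ℤ) : |kAbs k - kAbs l| ≤ kAbs (k + l) := by
  have h := abs_norm_sub_norm_le (WithLp.toLp 2 fun i => (k i : ℝ))
    (-WithLp.toLp 2 fun i => (l i : ℝ))
  rw [norm_neg, sub_neg_eq_add, ← WithLp.toLp_add, ← eNorm_eq_norm, ← eNorm_eq_norm,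
    ← eNorm_eq_norm] at h
  have e : kAbs (k + l) = eNorm ((fun i => (k i : ℝ)) + fun i => (l i : ℝ)) := by
    rw [kAbs]; congr 1; ext i; simp
  rw [e]
  exact h

lemma norm_Tsym_le (k l : Fin 2 → ℤ) : ‖Tsym k l‖ ≤ 1 := by
  rw [Tsym, Complex.norm_real, Real.norm_eq_abs, abs_div, abs_of_nonneg (kAbs_nonneg _)]
  exact div_le_one_of_le₀ (abs_kAbs_sub_le k l) (kAbs_nonneg _)

section HBoundAlgebra

variable {ι : Type*} {κ : ι → Fin 2 → ℤ} {c d : ι → ℂ} {α A B : ℝ}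

lemma HB.add (hc : Rapid κ c) (hd : Rapid κ d) (h : HB α κ c A) (h' : HB α κ d B) :
    HB α κ (fun j => c j + d j) (A + B) := by
  refine ⟨fun x => ?_, fun x v => ?_⟩
  · rw [trig_add hc.summable hd.summable]
    exact (norm_add_le _ _).trans (add_le_add (h.1 x) (h'.1 x))
  · rw [trig_add hc.summable hd.summable, trig_add hc.summable hd.summable, add_sub_add_comm,
      add_mul]
    exact (norm_add_le _ _).trans (add_le_add (h.2 x v) (h'.2 x v))

lemma HB.const_mul (h : HB α κ c A) (a : ℂ) : HB α κ (fun j => a * c j) (‖a‖ * A) := by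
  refine ⟨fun x => ?_, fun x v => ?_⟩
  · rw [trig_const_mul, norm_mul]
    exact mul_le_mul_of_nonneg_left (h.1 x) (norm_nonneg _)
  · rw [trig_const_mul, trig_const_mul, ← mul_sub, norm_mul, mul_assoc]
    exact mul_le_mul_of_nonneg_left (h.2 x v) (norm_nonneg _)

lemma HB.mono (h : HB α κ c A) (hAB : A ≤ B) : HB α κ c B :=
  ⟨fun x => (h.1 x).trans hAB, fun x v => (h.2 x v).trans (by gcongr)⟩

lemma HB.sum {σ : Type*} (s : Finset σ) {d : σ → ι → ℂ} {A : σ → ℝ}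
    (hd : ∀ i ∈ s, Rapid κ (d i)) (h : ∀ i ∈ s, HB α κ (d i) (A i)) :
    HB α κ (fun j => ∑ i ∈ s, d i j) (∑ i ∈ s, A i) := by
  refine ⟨fun x => ?_, fun x v => ?_⟩
  · rw [trig_sum s fun i hi => (hd i hi).summable]
    exact norm_sum_le_of_le _ fun i hi => (h i hi).1 x
  · rw [trig_sum s fun i hi => (hd i hi).summable, trig_sum s fun i hi => (hd i hi).summable,
      ← Finset.sum_sub_distrib, Finset.sum_mul]
    exact norm_sum_le_of_le _ fun i hi => (h i hi).2 x v

end HBoundAlgebra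

/-- Constant for the bilinear operator in the case of no derivatives. -/
def tC (α : ℝ) : ℝ := 8 * czC α ^ 2 * poiK ^ 3

lemma tC_pos {α : ℝ} (hα0 : 0 < α) (hα1 : α < 1) : 0 < tC α := by
  have := czC_pos hα0 hα1
  have := poiK_pos
  unfold tC; positivity

lemma HB.Tsym {ι ι' : Type*} [Countable ι] [Countable ι'] {κ : ι → Fin 2 → ℤ}
    {κ' : ι' → Fin 2 → ℤ} {a : ι → ℂ} {b : ι' → ℂ} {α A B : ℝ}
    (hα0 : 0 < α) (hα1 : α < 1) (ha : Rapid κ a) (hb : Rapid κ' b)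
    (hA : HB α κ a A) (hB : HB α κ' b B) :
    HB α (pairFreq κ κ') (fun p => Tsym (κ p.1) (κ' p.2) * (a p.1 * b p.2)) (tC α * A * B) := by
  have hbil : ∀ i, Rapid (pairFreq κ κ') fun p => (Dsym i (κ p.1) - Dsym i (κ' p.2)) /
      ((kAbs (κ p.1) + kAbs (κ' p.2) : ℝ) : ℂ) * (a p.1 * b p.2) :=
    fun i => (ha.pair hb).mul_bdd fun p => norm_Bsym_le i _ _
  have h := (HB.sum Finset.univ
    (fun i _ => (hbil i).mul_bdd fun p => norm_Rsym_le i (pairFreq κ κ' p))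
    (fun i _ => (HB.bilinear hα0 hα1 ha hb hA hB i).riesz hα0 hα1 (hbil i) i)).const_mul (-1)
  convert h using 1
  · ext p
    rw [Tsym_eq, mul_assoc, Finset.sum_mul]
    congr 1
    refine Finset.sum_congr rfl fun i _ => ?_
    rw [pairFreq]; ring
  · simp [tC]; ring

/-! ### The Hölder norm of a trigonometric series and interpolation -/

/-- The least `C^α` bound of a trigonometric series. -/
def hbN {ι : Type*} (α : ℝ) (κ : ι → Fin 2 → ℤ) (c : ι → ℂ) : ℝ := sInf {A | HB α κ c A}

section HolderNorm

variable {ι : Type*} {κ : ι → Fin 2 → ℤ} {c : ι → ℂ} {α A : ℝ}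

lemma norm_trig_le (hc : Summable fun j => ‖c j‖) (x : Vd 2) : ‖trig κ c x‖ ≤ ∑' j, ‖c j‖ := by
  refine (norm_tsum_le_tsum_norm ?_).trans_eq ?_
  · simpa [norm_tchar] using hc
  · simp [norm_tchar]

lemma le_rpow_of_le_of_le_mul {y H L r : ℝ} (hα0 : 0 < α) (hα1 : α < 1) (hr : 0 ≤ r)
    (h1 : y ≤ H) (h2 : y ≤ L * r) (hH : 0 ≤ H) (hL : 0 ≤ L) : y ≤ (H + L) * r ^ α := by
  rcases le_total r 1 with h | h
  · have : r ≤ r ^ α := by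
      rcases hr.eq_or_lt with rfl | hr0
      · simp [Real.zero_rpow hα0.ne']
      · simpa using Real.rpow_le_rpow_of_exponent_ge hr0 h hα1.le
    have h3 : L * r ≤ L * r ^ α := by gcongr
    have h4 : 0 ≤ H * r ^ α := by positivity
    linarith
  · have h3 : 1 ≤ r ^ α := Real.one_le_rpow h hα0.le
    nlinarith

lemma exists_HB (hα0 : 0 < α) (hα1 : α < 1) (hc : Rapid κ c) : ∃ A, HB α κ c A := by
  set S := ∑' j, ‖c j‖
  set M := ∑ i, ∑' j, ‖Dsym i (κ j) * c j‖
  have hS : 0 ≤ S := tsum_nonneg fun _ => norm_nonneg _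
  have hM : 0 ≤ M := Finset.sum_nonneg fun i _ => tsum_nonneg fun _ => norm_nonneg _
  have hD : ∀ i x, ‖trig κ (fun j => Dsym i (κ j) * c j) x‖ ≤ M := fun i x =>
    (norm_trig_le (hc.Dsym i).summable x).trans (Finset.single_le_sum
      (f := fun i => ∑' j, ‖Dsym i (κ j) * c j‖)
      (fun i _ => tsum_nonneg fun _ => norm_nonneg _) (Finset.mem_univ i))
  refine ⟨2 * S + 2 * M, fun x => ?_, fun x v => ?_⟩
  · have := norm_trig_le (κ := κ) hc.summable x
    linarith
  · refine le_rpow_of_le_of_le_mul hα0 hα1 (norm_nonneg v) ?_ (norm_trig_diff_le hc hD x v)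
      (by positivity) (by positivity)
    have h1 := norm_trig_le (κ := κ) hc.summable x
    have h2 := norm_trig_le (κ := κ) hc.summable (x + v)
    exact (norm_sub_le _ _).trans (by linarith)

lemma bddBelow_HB : BddBelow {A | HB α κ c A} := ⟨0, fun _ h => HB.nonneg h⟩

lemma hbN_le (h : HB α κ c A) : hbN α κ c ≤ A := csInf_le bddBelow_HB h

lemma hbN_nonneg : 0 ≤ hbN α κ c := Real.sInf_nonneg fun _ h => HB.nonneg h

lemma HB_hbN (hα0 : 0 < α) (hα1 : α < 1) (hc : Rapid κ c) : HB α κ c (hbN α κ c) := by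
  have hne : {A | HB α κ c A}.Nonempty := exists_HB hα0 hα1 hc
  refine ⟨fun x => le_csInf hne fun A h => h.1 x, fun x v => ?_⟩
  rcases eq_or_ne v 0 with rfl | hv
  · simp [Real.zero_rpow hα0.ne']
  · have hv' : 0 < ‖v‖ ^ α := Real.rpow_pos_of_pos (norm_pos_iff.2 hv) α
    rw [← div_le_iff₀ hv']
    exact le_csInf hne fun A h => (div_le_iff₀ hv').2 (h.2 x v)

lemma hasDerivAt_trig_line (hc : Rapid κ c) (x : Vd 2) (i : Fin 2) (s : ℝ) :
    HasDerivAt (fun s : ℝ => trig κ c (x + s • Pi.single i 1))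
      (trig κ (fun j => Dsym i (κ j) * c j) (x + s • Pi.single i 1)) s := by
  have h1 : HasDerivAt (fun s : ℝ => x + s • (Pi.single i 1 : Vd 2)) (Pi.single i 1) s := by
    simpa using ((hasDerivAt_id s).smul_const (Pi.single i 1 : Vd 2)).const_add x
  refine ((hasFDerivAt_trig hc _).comp_hasDerivAt s h1).congr_deriv ?_
  fin_cases i <;> simp [coordC_apply]

/-- Landau's inequality for the sup norm of a first derivative. -/
lemma norm_trig_Dsym_le_landau (hc : Rapid κ c) (i : Fin 2) {M₀ M₂ h : ℝ} (hh : 0 < h)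
    (h0 : ∀ x, ‖trig κ c x‖ ≤ M₀)
    (h2 : ∀ x, ‖trig κ (fun j => Dsym i (κ j) * (Dsym i (κ j) * c j)) x‖ ≤ M₂) (x : Vd 2) :
    ‖trig κ (fun j => Dsym i (κ j) * c j) x‖ ≤ 2 * M₀ / h + h * M₂ := by
  set e : Vd 2 := Pi.single i 1
  set D := trig κ (fun j => Dsym i (κ j) * c j)
  have hM₂ : 0 ≤ M₂ := (norm_nonneg _).trans (h2 0)
  have hD : ∀ s ∈ Set.Icc 0 h, ‖D (x + s • e) - D x‖ ≤ h * M₂ := by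
    intro s hs
    have := (convex_Icc 0 h).norm_image_sub_le_of_norm_hasDerivWithin_le (C := M₂)
      (fun y _ => (hasDerivAt_trig_line (hc.Dsym i) x i y).hasDerivWithinAt)
      (fun y _ => h2 _) (Set.left_mem_Icc.2 hh.le) hs
    simp only [zero_smul, add_zero, sub_zero] at this
    refine this.trans ?_
    rw [Real.norm_of_nonneg hs.1, mul_comm]
    exact mul_le_mul_of_nonneg_right hs.2 hM₂
  have key := (convex_Icc 0 h).norm_image_sub_le_of_norm_hasDerivWithin_le (C := h * M₂)
    (f := fun s : ℝ => trig κ c (x + s • e) - s • D x)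
    (f' := fun s => D (x + s • e) - (1 : ℝ) • D x)
    (fun y _ => ((hasDerivAt_trig_line hc x i y).sub
      ((hasDerivAt_id y).smul_const (D x))).hasDerivWithinAt)
    (fun y hy => by rw [one_smul]; exact hD y hy) (Set.left_mem_Icc.2 hh.le)
    (Set.right_mem_Icc.2 hh.le)
  simp only [zero_smul, add_zero, sub_zero, Real.norm_of_nonneg hh.le] at key
  have e1 : h • D x = (trig κ c (x + h • e) - trig κ c x) -
      (trig κ c (x + h • e) - h • D x - trig κ c x) := by abel
  have e2 : h * ‖D x‖ ≤ 2 * M₀ + h * M₂ * h := by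
    rw [← Real.norm_of_nonneg hh.le, ← norm_smul, e1, Real.norm_of_nonneg hh.le]
    refine (norm_sub_le _ _).trans (add_le_add ((norm_sub_le _ _).trans ?_) key)
    linarith [h0 x, h0 (x + h • e)]
  rw [← mul_le_mul_iff_right₀ hh]
  calc h * ‖D x‖ ≤ 2 * M₀ + h * M₂ * h := e2
    _ = h * (2 * M₀ / h + h * M₂) := by field_simp

lemma HB.landau (hc : Rapid κ c) (i : Fin 2) {A B h : ℝ} (hh : 0 < h) (h0 : HB α κ c A)
    (h2 : HB α κ (fun j => Dsym i (κ j) * (Dsym i (κ j) * c j)) B) :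
    HB α κ (fun j => Dsym i (κ j) * c j) (2 * A / h + h * B) := by
  refine ⟨norm_trig_Dsym_le_landau hc i hh h0.1 h2.1, fun x v => ?_⟩
  have := norm_trig_Dsym_le_landau (hc.diff v) i hh (M₀ := A * ‖v‖ ^ α) (M₂ := B * ‖v‖ ^ α)
    (fun x => by rw [trig_diff hc.summable]; exact h0.2 x v)
    (fun x => by
      simp only [mul_left_comm _ (tchar _ v - 1)]
      rw [trig_diff ((hc.Dsym i).Dsym i).summable]; exact h2.2 x v) x
  simp only [mul_left_comm _ (tchar _ v - 1)] at this
  rw [trig_diff (hc.Dsym i).summable] at this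
  exact this.trans_eq (by ring)

lemma sq_le_of_forall_le_div_add_mul {X A B : ℝ} (hX : 0 ≤ X) (hA : 0 ≤ A) (hB : 0 ≤ B)
    (h : ∀ s : ℝ, 0 < s → X ≤ 2 * A / s + s * B) : X ^ 2 ≤ 8 * (A * B) := by
  rcases hX.eq_or_lt with rfl | hX0
  · have := mul_nonneg hA hB
    nlinarith
  rcases hB.eq_or_lt with rfl | hB0
  · have hs : 0 < 4 * A / X + 1 := by positivity
    have := h _ hs
    rw [mul_zero, add_zero, le_div_iff₀ hs] at this
    have e : X * (4 * A / X + 1) = 4 * A + X := by field_simp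
    rw [e] at this
    linarith
  · have := h (X / (2 * B)) (by positivity)
    have e : 2 * A / (X / (2 * B)) + X / (2 * B) * B = 4 * (A * B) / X + X / 2 := by
      field_simp; ring
    rw [e] at this
    have h3 : X / 2 ≤ 4 * (A * B) / X := by linarith
    rw [le_div_iff₀ hX0] at h3
    nlinarith

lemma hbN_Dsym_sq_le (hα0 : 0 < α) (hα1 : α < 1) (hc : Rapid κ c) (i : Fin 2) :
    hbN α κ (fun j => Dsym i (κ j) * c j) ^ 2 ≤
      8 * (hbN α κ c * hbN α κ fun j => Dsym i (κ j) * (Dsym i (κ j) * c j)) :=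
  sq_le_of_forall_le_div_add_mul hbN_nonneg hbN_nonneg hbN_nonneg fun _ hs =>
    hbN_le (HB.landau hc i hs (HB_hbN hα0 hα1 hc) (HB_hbN hα0 hα1 ((hc.Dsym i).Dsym i)))

/-- Symbol of the iterated partial derivative along the word `w`. -/
def wsym {n : ℕ} (w : Fin n → Fin 2) (k : Fin 2 → ℤ) : ℂ := ∏ j, Dsym (w j) k

lemma wsym_cons {n : ℕ} (i : Fin 2) (w : Fin n → Fin 2) (k : Fin 2 → ℤ) :
    wsym (Fin.cons i w : Fin (n + 1) → Fin 2) k = Dsym i k * wsym w k := by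
  simp [wsym, Fin.prod_univ_succ]

lemma Rapid.wsym (hc : Rapid κ c) {n : ℕ} (w : Fin n → Fin 2) :
    Rapid κ fun j => wsym w (κ j) * c j := by
  refine hc.mul (M := 1) (p := n) fun j => ?_
  rw [_root_.wsym, norm_prod, one_mul]
  calc ∏ m, ‖_root_.Dsym (w m) (κ j)‖ ≤ ∏ _m : Fin n, (1 + ‖κ j‖) := by
        refine Finset.prod_le_prod (fun _ _ => norm_nonneg _) fun m _ => ?_
        simpa using norm_Dsym_le_norm (w m) (κ j)
    _ = _ := by simp

/-- The largest `C^α` norm of an iterated partial derivative of order `n`. -/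
def derN {ι : Type*} (α : ℝ) (κ : ι → Fin 2 → ℤ) (c : ι → ℂ) (n : ℕ) : ℝ :=
  ⨆ w : Fin n → Fin 2, hbN α κ fun j => wsym w (κ j) * c j

lemma hbN_le_derN {n : ℕ} (w : Fin n → Fin 2) :
    hbN α κ (fun j => wsym w (κ j) * c j) ≤ derN α κ c n :=
  le_ciSup (f := fun w : Fin n → Fin 2 => hbN α κ fun j => wsym w (κ j) * c j)
    (Set.finite_range _).bddAbove w

lemma derN_nonneg (n : ℕ) : 0 ≤ derN α κ c n := Real.iSup_nonneg fun _ => hbN_nonneg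

lemma derN_sq_le (hα0 : 0 < α) (hα1 : α < 1) (hc : Rapid κ c) (n : ℕ) :
    derN α κ c (n + 1) ^ 2 ≤ 8 * (derN α κ c n * derN α κ c (n + 2)) := by
  obtain ⟨w, hw⟩ := exists_eq_ciSup_of_finite
    (f := fun w : Fin (n + 1) → Fin 2 => hbN α κ fun j => wsym w (κ j) * c j)
  have hcons := Fin.cons_self_tail w
  have e1 : ∀ j, wsym w (κ j) * c j = Dsym (w 0) (κ j) * (wsym (Fin.tail w) (κ j) * c j) := by
    intro j
    conv_lhs => rw [← hcons, wsym_cons]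
    ring
  have h1 : derN α κ c (n + 1) =
      hbN α κ fun j => Dsym (w 0) (κ j) * (wsym (Fin.tail w) (κ j) * c j) := by
    rw [derN, ← hw]; simp only [e1]
  have h2 := hbN_Dsym_sq_le hα0 hα1 (hc.wsym (Fin.tail w)) (w 0)
  have h3 : hbN α κ (fun j => Dsym (w 0) (κ j) * (Dsym (w 0) (κ j) *
      (wsym (Fin.tail w) (κ j) * c j))) ≤ derN α κ c (n + 2) := by
    have := hbN_le_derN (α := α) (κ := κ) (c := c)
      (Fin.cons (w 0) w : Fin (n + 2) → Fin 2)
    simpa only [wsym_cons, mul_assoc, e1] using this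
  rw [h1]
  refine h2.trans ?_
  have := hbN_le_derN (α := α) (κ := κ) (c := c) (Fin.tail w)
  have h4 := derN_nonneg (α := α) (κ := κ) (c := c) n
  gcongr
  exact hbN_nonneg

lemma HB.prod_derN (hα0 : 0 < α) (hα1 : α < 1) (hc : Rapid κ c) {n : ℕ} (w : Fin n → Fin 2)
    (S : Finset (Fin n)) :
    Rapid κ (fun j => (∏ m ∈ S, Dsym (w m) (κ j)) * c j) ∧
    HB α κ (fun j => (∏ m ∈ S, Dsym (w m) (κ j)) * c j) (derN α κ c S.card) := by
  have e : ∀ k, ∏ m ∈ S, Dsym (w m) k = wsym (fun m => w (S.equivFin.symm m)) k := by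
    intro k
    rw [wsym, Equiv.prod_comp S.equivFin.symm (fun m : S => Dsym (w m) k)]
    exact (Finset.prod_coe_sort S fun m => Dsym (w m) k).symm
  simp only [e]
  exact ⟨hc.wsym _, (HB_hbN hα0 hα1 (hc.wsym _)).mono (hbN_le_derN _)⟩

end HolderNorm

/-- Sequences which are log-convex up to a constant are controlled by their end values. -/
lemma le_of_sq_le_mul {u : ℕ → ℝ} {n : ℕ} (hu : ∀ k, 0 ≤ u k)
    (h : ∀ k, k + 2 ≤ n → u (k + 1) ^ 2 ≤ 64 * (u k * u (k + 2))) {k : ℕ} (hk : k ≤ n) :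
    u k ≤ 8 ^ n ^ 2 * (u 0 + u n) := by
  set q : ℕ → ℝ := fun k => 8 ^ k ^ 2 * u k with hq
  have hq0 : ∀ k, 0 ≤ q k := fun k => mul_nonneg (by positivity) (hu k)
  have hqc : ∀ k, k + 2 ≤ n → q (k + 1) ^ 2 ≤ q k * q (k + 2) := by
    intro k hk
    have e : (8 : ℝ) ^ (k ^ 2) * 8 ^ ((k + 2) ^ 2) = (8 ^ ((k + 1) ^ 2)) ^ 2 * 64 := by
      rw [← pow_mul, ← pow_add, show (64 : ℝ) = 8 ^ 2 by norm_num, ← pow_add]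
      ring_nf
    calc q (k + 1) ^ 2 = (8 ^ ((k + 1) ^ 2)) ^ 2 * u (k + 1) ^ 2 := by rw [hq]; ring
      _ ≤ (8 ^ ((k + 1) ^ 2)) ^ 2 * (64 * (u k * u (k + 2))) := by gcongr; exact h k hk
      _ = ((8 : ℝ) ^ (k ^ 2) * 8 ^ ((k + 2) ^ 2)) * (u k * u (k + 2)) := by rw [e]; ring
      _ = q k * q (k + 2) := by rw [hq]; ring
  obtain ⟨m, hm, hmax⟩ := Finset.exists_max_image (Finset.range (n + 1)) q ⟨0, by simp⟩
  have hex : ∃ m, m ≤ n ∧ ∀ j ≤ n, q j ≤ q m :=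
    ⟨m, by simpa [Nat.lt_succ_iff] using hm, fun j hj => hmax j (by simpa [Nat.lt_succ_iff])⟩
  classical
  obtain ⟨hmn, hmq⟩ := Nat.find_spec hex
  have hmin := fun j => Nat.find_min hex (m := j)
  generalize Nat.find hex = m at hmn hmq hmin
  have hends : q m ≤ q 0 + q n := by
    rcases m with _ | m
    · linarith [hq0 n]
    rcases hmn.eq_or_lt with rfl | hlt
    · linarith [hq0 0]
    · exfalso
      have hlt' : q m < q (m + 1) := by
        by_contra! hle
        exact hmin m (Nat.lt_succ_self m) ⟨by omega, fun j hj => (hmq j hj).trans hle⟩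
      have h1 := hqc m (by omega)
      have h2 := hmq (m + 2) (by omega)
      nlinarith [hq0 m, hq0 (m + 2)]
  calc u k ≤ q k := le_mul_of_one_le_left (hu k) (one_le_pow₀ (by norm_num))
    _ ≤ q 0 + q n := (hmq k hk).trans hends
    _ = u 0 + 8 ^ n ^ 2 * u n := by
      rw [hq]
      simp only [ne_eq, OfNat.ofNat_ne_zero, not_false_eq_true, zero_pow, pow_zero, one_mul]
    _ ≤ 8 ^ n ^ 2 * (u 0 + u n) := by
      rw [mul_add]
      gcongr
      exact le_mul_of_one_le_left (hu 0) (one_le_pow₀ (by norm_num))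

/-- Higher order Hölder estimates for the bilinear operator. -/
lemma HB.wsym_Tsym {ι ι' : Type*} [Countable ι] [Countable ι'] {κ : ι → Fin 2 → ℤ}
    {κ' : ι' → Fin 2 → ℤ} {a : ι → ℂ} {b : ι' → ℂ} {α : ℝ} (hα0 : 0 < α) (hα1 : α < 1)
    (ha : Rapid κ a) (hb : Rapid κ' b) {n : ℕ} (w : Fin n → Fin 2) :
    HB α (pairFreq κ κ')
      (fun p => _root_.wsym w (pairFreq κ κ' p) *
        (_root_.Tsym (κ p.1) (κ' p.2) * (a p.1 * b p.2)))
      (2 ^ n * (tC α * (8 ^ n ^ 2 *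
        (derN α κ a 0 * derN α κ' b n + derN α κ a n * derN α κ' b 0)))) := by
  have h1 := fun S => HB.prod_derN hα0 hα1 ha w S
  have h2 := fun S => HB.prod_derN hα0 hα1 hb w S
  have hr : ∀ S : Finset (Fin n), Rapid (pairFreq κ κ') fun p => _root_.Tsym (κ p.1) (κ' p.2) *
      (((∏ m ∈ S, Dsym (w m) (κ p.1)) * a p.1) *
      ((∏ m ∈ Finset.univ \ S, Dsym (w m) (κ' p.2)) * b p.2)) := fun S =>
    ((h1 S).1.pair (h2 (Finset.univ \ S)).1).mul_bdd
      (m := fun p : ι × ι' => _root_.Tsym (κ p.1) (κ' p.2)) fun p => norm_Tsym_le _ _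
  have hB : ∀ S : Finset (Fin n), HB α (pairFreq κ κ') (fun p => _root_.Tsym (κ p.1) (κ' p.2) *
      (((∏ m ∈ S, Dsym (w m) (κ p.1)) * a p.1) *
      ((∏ m ∈ Finset.univ \ S, Dsym (w m) (κ' p.2)) * b p.2)))
      (tC α * derN α κ a S.card * derN α κ' b (Finset.univ \ S).card) := by
    intro S
    have := HB.Tsym hα0 hα1 (h1 S).1 (h2 (Finset.univ \ S)).1 (h1 S).2 (h2 (Finset.univ \ S)).2
    exact this
  have hT := HB.sum (Finset.univ : Finset (Fin n)).powerset (fun S _ => hr S) fun S _ => hB S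
  have e : ∀ p : ι × ι', _root_.wsym w (pairFreq κ κ' p) *
      (_root_.Tsym (κ p.1) (κ' p.2) * (a p.1 * b p.2)) =
      ∑ S ∈ (Finset.univ : Finset (Fin n)).powerset, _root_.Tsym (κ p.1) (κ' p.2) *
        (((∏ m ∈ S, Dsym (w m) (κ p.1)) * a p.1) *
        ((∏ m ∈ Finset.univ \ S, Dsym (w m) (κ' p.2)) * b p.2)) := by
    intro p
    simp only [_root_.wsym, pairFreq, Dsym_add]
    rw [Finset.prod_add, Finset.sum_mul]
    refine Finset.sum_congr rfl fun S _ => ?_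
    ring
  simp only [e]
  refine hT.mono ?_
  have hcard : (2 : ℝ) ^ n = ((Finset.univ : Finset (Fin n)).powerset.card : ℝ) := by simp
  rw [hcard, ← nsmul_eq_mul]
  refine Finset.sum_le_card_nsmul _ _ _ fun S _ => ?_
  have hS : S.card ≤ n := by simpa using Finset.card_le_univ S
  have hS' : (Finset.univ \ S).card = n - S.card := by
    rw [Finset.card_sdiff_of_subset (Finset.subset_univ S)]; simp
  rw [hS', mul_assoc]
  refine mul_le_mul_of_nonneg_left ?_ (tC_pos hα0 hα1).le
  have key := le_of_sq_le_mul (u := fun k => derN α κ a k * derN α κ' b (n - k)) (n := n)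
    (fun k => mul_nonneg (derN_nonneg _) (derN_nonneg _)) (fun k hk => ?_) hS
  · simpa using key
  · have k1 := derN_sq_le hα0 hα1 ha k
    have k2 := derN_sq_le hα0 hα1 hb (n - (k + 2))
    rw [show n - (k + 2) + 1 = n - (k + 1) by omega,
      show n - (k + 2) + 2 = n - k by omega] at k2
    rw [mul_pow]
    refine (mul_le_mul k1 k2 (sq_nonneg _) ((sq_nonneg _).trans k1)).trans_eq (by ring)

/-! ### Fourier coefficients and multipliers of trigonometric series -/

lemma tchar_eq_prod (k : Fin 2 → ℤ) (x : Vd 2) :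
    tchar k x = ∏ i, Complex.exp (Complex.I * k i * x i) := by
  rw [tchar, dotZ_eq, Fin.prod_univ_two, ← Complex.exp_add]
  congr 1; push_cast; ring

lemma integral_Icc_exp (n : ℤ) :
    ∫ y in Set.Icc (0 : ℝ) (2 * Real.pi), Complex.exp (Complex.I * n * y)
      = if n = 0 then 2 * (Real.pi : ℂ) else 0 := by
  rw [integral_Icc_eq_integral_Ioc, ← intervalIntegral.integral_of_le (by positivity)]
  split_ifs with h
  · simp [h]
  · have hn : Complex.I * n ≠ 0 := by simp [h]
    rw [integral_exp_mul_complex hn]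
    have : Complex.exp (Complex.I * n * ((2 * Real.pi : ℝ) : ℂ)) = 1 :=
      Complex.exp_eq_one_iff.2 ⟨n, by push_cast; ring⟩
    rw [this]; simp

lemma volume_restrict_box (d : ℕ) : (volume : Measure (Vd d)).restrict (box d)
    = Measure.pi fun _ => volume.restrict (Set.Icc (0 : ℝ) (2 * Real.pi)) := by
  have : box d = Set.univ.pi fun _ => Set.Icc (0 : ℝ) (2 * Real.pi) := by
    rw [Set.pi_univ_Icc]; rfl
  rw [this, volume_pi, Measure.restrict_pi_pi]

lemma integral_box_tchar (k : Fin 2 → ℤ) :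
    ∫ x in box 2, tchar k x = if k = 0 then (2 * (Real.pi : ℂ)) ^ 2 else 0 := by
  simp_rw [tchar_eq_prod, volume_restrict_box]
  rw [integral_fintype_prod_eq_prod (fun (i : Fin 2) (y : ℝ) => Complex.exp (Complex.I * k i * y))]
  simp_rw [integral_Icc_exp, Fin.prod_univ_two, funext_iff, Fin.forall_fin_two, Pi.zero_apply]
  by_cases h0 : k 0 = 0 <;> by_cases h1 : k 1 = 0 <;> simp [h0, h1, sq]

lemma exp_neg_dotZ (k : Fin 2 → ℤ) (x : Vd 2) :
    Complex.exp (-(Complex.I * (dotZ k x : ℂ))) = tchar (-k) x := by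
  rw [tchar, dotZ_eq, dotZ_eq]; congr 1; push_cast [Pi.neg_apply]; ring

lemma fCoeff_eq (f : Vd 2 → ℂ) (k : Fin 2 → ℤ) :
    fCoeff f k = ((2 * (Real.pi : ℂ)) ^ 2)⁻¹ * ∫ x in box 2, f x * tchar (-k) x := by
  simp_rw [fCoeff, exp_neg_dotZ, Complex.real_smul]
  push_cast; rfl

lemma isCompact_box (d : ℕ) : IsCompact (box d) := isCompact_Icc

section Multiplier

variable {ι : Type*} [Countable ι] {κ : ι → Fin 2 → ℤ} {c : ι → ℂ}

lemma fCoeff_trig (hc : Summable fun j => ‖c j‖) (k : Fin 2 → ℤ) :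
    fCoeff (trig κ c) k = ∑' j : κ ⁻¹' {k}, c j := by
  have hfin : IsFiniteMeasure ((volume : Measure (Vd 2)).restrict (box 2)) :=
    ⟨by rw [Measure.restrict_apply_univ]; exact (isCompact_box 2).measure_lt_top⟩
  have h1 : ∀ x, trig κ c x * tchar (-k) x = ∑' j, c j * tchar (κ j - k) x := by
    intro x
    rw [trig, ← tsum_mul_right]
    refine tsum_congr fun j => ?_
    rw [sub_eq_add_neg, tchar_add_left, mul_assoc]
  have hp : (2 * (Real.pi : ℂ)) ^ 2 ≠ 0 := by simp [Real.pi_ne_zero]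
  rw [fCoeff_eq]
  simp_rw [h1]
  rw [← integral_tsum_of_summable_integral_norm]
  · simp_rw [integral_const_mul, integral_box_tchar, sub_eq_zero]
    rw [tsum_subtype (κ ⁻¹' {k}) c, ← tsum_mul_left]
    refine tsum_congr fun j => ?_
    by_cases hj : κ j = k
    · rw [Set.indicator_of_mem (by simpa using hj), if_pos hj]; field_simp
    · rw [Set.indicator_of_notMem (by simpa using hj), if_neg hj]; simp
  · intro j
    exact ((continuous_const.mul (continuous_tchar _)).continuousOn.integrableOn_compact
      (isCompact_box 2))
  · simp_rw [norm_mul, norm_tchar, mul_one, integral_const, smul_eq_mul]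
    exact hc.mul_left _

lemma fmul_trig {m : (Fin 2 → ℤ) → ℂ} (hc : Summable fun j => ‖c j‖)
    (hm : Summable fun j => ‖m (κ j) * c j‖) :
    fmul m (trig κ c) = trig κ fun j => m (κ j) * c j := by
  funext x
  have h := ((summable_trig (κ := κ) hm x).hasSum.tsum_fiberwise κ).tsum_eq
  rw [trig, ← h, fmul]
  refine tsum_congr fun k => ?_
  rw [fCoeff_trig hc, ← tsum_mul_left, ← tsum_mul_right]
  refine tsum_congr fun j => ?_
  have hj : κ j = k := j.2
  rw [hj]; rfl

end Multiplier

/-! ### Fourier inversion for smooth functions on the torus -/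

section Inversion

variable {F : Vd 2 → ℂ}

/-- The covering map from the plane onto the unit torus. -/
def torusMk : (Fin 2 → ℝ) → UnitAddTorus (Fin 2) := fun y i => (y i : UnitAddCircle)

lemma isOpenQuotientMap_torusMk : IsOpenQuotientMap torusMk :=
  IsOpenQuotientMap.piMap (A := fun _ : Fin 2 => ℝ) fun _ => QuotientAddGroup.isOpenQuotientMap_mk

lemma mFourier_torusMk (k : Fin 2 → ℤ) (y : Fin 2 → ℝ) :
    UnitAddTorus.mFourier k (torusMk y) = tchar k ((2 * Real.pi) • y) := by
  rw [tchar_eq_prod]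
  change ∏ i, fourier (k i) (y i : UnitAddCircle) = _
  refine Finset.prod_congr rfl fun i _ => ?_
  rw [fourier_coe_apply]
  congr 1
  simp only [Pi.smul_apply, smul_eq_mul]; push_cast; ring

lemma exists_lift (hF : Continuous F) (hp : TorusFun F) :
    ∃ g : C(UnitAddTorus (Fin 2), ℂ), ∀ y, g (torusMk y) = F ((2 * Real.pi) • y) := by
  have hq := isOpenQuotientMap_torusMk
  have key : ∀ y, F ((2 * Real.pi) • Function.surjInv hq.surjective (torusMk y))
      = F ((2 * Real.pi) • y) := by
    intro y
    have h := Function.surjInv_eq hq.surjective (torusMk y)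
    have h2 : ∀ i, ∃ n : ℤ, Function.surjInv hq.surjective (torusMk y) i = y i + n := by
      intro i
      have h3 := congrFun h.symm i
      obtain ⟨n, hn⟩ := (QuotientAddGroup.eq_iff_sub_mem.1 h3.symm)
      refine ⟨n, ?_⟩
      simp only [zsmul_eq_mul, mul_one] at hn
      linarith
    choose n hn using h2
    rw [← hp ((2 * Real.pi) • y) n]
    congr 1
    funext i
    simp only [Pi.smul_apply, Pi.add_apply, smul_eq_mul, latt, hn]; ring
  refine ⟨⟨fun t => F ((2 * Real.pi) • Function.surjInv hq.surjective t), ?_⟩, key⟩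
  rw [hq.isQuotientMap.continuous_iff]
  refine (hF.comp (continuous_const_smul (2 * Real.pi))).congr fun y => (key y).symm

open scoped Pointwise in
lemma mFourierCoeff_lift {g : C(UnitAddTorus (Fin 2), ℂ)}
    (hg : ∀ y, g (torusMk y) = F ((2 * Real.pi) • y)) (k : Fin 2 → ℤ) :
    UnitAddTorus.mFourierCoeff g k = fCoeff F k := by
  have hpi : 0 < 2 * Real.pi := by positivity
  rw [UnitAddTorus.mFourierCoeff_eq_integral g k 0]
  have h1 : ∀ y : Fin 2 → ℝ, UnitAddTorus.mFourier (-k) (fun i => (y i : UnitAddCircle)) •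
      g (fun i => (y i : UnitAddCircle))
      = (fun x => F x * tchar (-k) x) ((2 * Real.pi) • y) := by
    intro y
    have := mFourier_torusMk (-k) y
    have h2 := hg y
    unfold torusMk at this h2
    rw [this, h2, smul_eq_mul, mul_comm]
  rw [integral_congr_ae (.of_forall h1)]
  have h2 : {x : Fin 2 → ℝ | ∀ i, x i ∈ Set.Ioc ((0 : Fin 2 → ℝ) i) ((0 : Fin 2 → ℝ) i + 1)}
      = Set.univ.pi fun i => Set.Ioc ((0 : Fin 2 → ℝ) i) ((1 : Fin 2 → ℝ) i) := by
    ext x; simp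
  rw [h2, volume_pi, setIntegral_congr_set Measure.univ_pi_Ioc_ae_eq_Icc, ← volume_pi,
    Measure.setIntegral_comp_smul_of_pos volume (fun x => F x * tchar (-k) x) _ hpi]
  have h3 : (2 * Real.pi) • Set.Icc (0 : Fin 2 → ℝ) 1 = box 2 := by
    ext x
    rw [Set.mem_smul_set_iff_inv_smul_mem₀ hpi.ne', box, Set.mem_Icc, Set.mem_Icc]
    simp only [Pi.le_def, Pi.smul_apply, smul_eq_mul, Pi.zero_apply, Pi.one_apply]
    refine and_congr (forall_congr' fun i => ?_) (forall_congr' fun i => ?_)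
    · exact mul_nonneg_iff_of_pos_left (inv_pos.2 hpi)
    · rw [inv_mul_le_iff₀ hpi, mul_one]
  rw [h3, fCoeff_eq, Complex.real_smul]
  simp

lemma eq_trig_fCoeff (hF : Continuous F) (hp : TorusFun F) (hs : Summable (fCoeff F)) :
    F = trig id (fCoeff F) := by
  obtain ⟨g, hg⟩ := exists_lift hF hp
  have hco : UnitAddTorus.mFourierCoeff g = fCoeff F := funext (mFourierCoeff_lift hg)
  funext x
  have h := UnitAddTorus.hasSum_mFourier_series_apply_of_summable (f := g) (by rwa [hco])
    (torusMk ((2 * Real.pi)⁻¹ • x))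
  have hx : (2 * Real.pi) • (2 * Real.pi)⁻¹ • x = x := smul_inv_smul₀ (by positivity) x
  rw [hco, hg, hx] at h
  simp_rw [mFourier_torusMk, hx] at h
  exact h.tsum_eq.symm

lemma integral_box_pd (hF : ContDiff ℝ 1 F) (hp : TorusFun F) (i : Fin 2) :
    ∫ x in box 2, pd i F x = 0 := by
  classical
  have hd : Differentiable ℝ F := hF.differentiable one_ne_zero
  have hc : Continuous (fderiv ℝ F) := hF.continuous_fderiv one_ne_zero
  have h := integral_divergence_of_hasFDerivAt_off_countable' (E := ℂ)
    (0 : Fin 2 → ℝ) (fun _ => 2 * Real.pi) (fun _ => by positivity)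
    (fun j => if j = i then F else 0) (fun j x => if j = i then fderiv ℝ F x else 0) ∅
    Set.countable_empty ?_ ?_ ?_
  · have e1 : ∀ x, (∑ j, (if j = i then fderiv ℝ F x else 0) (Pi.single j 1)) = pd i F x := by
      intro x
      rw [Finset.sum_eq_single i]
      · rw [if_pos rfl]; rfl
      · intro j _ hj; rw [if_neg hj]; rfl
      · simp
    simp_rw [e1] at h
    refine h.trans (Finset.sum_eq_zero fun j _ => ?_)
    rw [sub_eq_zero]
    refine integral_congr_ae (.of_forall fun y => ?_)
    rcases eq_or_ne j i with rfl | hj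
    · simp only [if_true]
      rw [← hp (Fin.insertNth j ((0 : Fin 2 → ℝ) j) y) (Pi.single j 1)]
      congr 1
      funext l
      rcases Fin.eq_self_or_eq_succAbove j l with rfl | ⟨m, rfl⟩
      · simp [latt]
      · simp [latt, Fin.succAbove_ne]
    · simp [hj]
  · intro j
    by_cases hj : j = i
    · simpa [hj] using hF.continuous.continuousOn
    · rw [if_neg hj]; exact continuousOn_const
  · intro x _ j
    by_cases hj : j = i
    · simpa [hj] using (hd x).hasFDerivAt
    · rw [if_neg hj, if_neg hj]; exact hasFDerivAt_const (0 : ℂ) x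
  · refine ContinuousOn.integrableOn_compact isCompact_Icc (Continuous.continuousOn ?_)
    refine continuous_finsetSum _ fun j _ => ?_
    by_cases hj : j = i
    · simpa [hj] using hc.clm_apply continuous_const
    · simpa [hj] using continuous_const

lemma TorusFun.pd (hp : TorusFun F) (i : Fin 2) : TorusFun (pd i F) := by
  intro x m
  unfold _root_.pd
  have : (fun y => F (y + latt m)) = F := funext fun y => hp y m
  rw [← fderiv_comp_add_right, this]

lemma contDiff_pd (hF : ContDiff ℝ (⊤ : ℕ∞) F) (i : Fin 2) : ContDiff ℝ (⊤ : ℕ∞) (pd i F) :=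
  (hF.fderiv_right (m := (⊤ : ℕ∞)) (by simp)).clm_apply contDiff_const

lemma contDiff_tchar (k : Fin 2 → ℤ) : ContDiff ℝ (⊤ : ℕ∞) (tchar k) := by
  have h : ContDiff ℝ (⊤ : ℕ∞) fun x : Vd 2 => (dotZ k x : ℂ) := by
    have h2 : ContDiff ℝ (⊤ : ℕ∞) (dotZ k) := by
      unfold dotZ; fun_prop
    exact Complex.ofRealCLM.contDiff.comp h2
  exact (contDiff_const.mul h).cexp

lemma fCoeff_pd (hF : ContDiff ℝ (⊤ : ℕ∞) F) (hp : TorusFun F) (i : Fin 2) (k : Fin 2 → ℤ) :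
    fCoeff (pd i F) k = Dsym i k * fCoeff F k := by
  have hd : Differentiable ℝ F := hF.differentiable (by simp)
  have hpr : ContDiff ℝ (⊤ : ℕ∞) fun x => F x * tchar (-k) x := hF.mul (contDiff_tchar _)
  have hper : TorusFun fun x => F x * tchar (-k) x := fun x m => by
    simp only [hp x m, tchar_add, tchar_latt, mul_one]
  have h0 := integral_box_pd (hpr.of_le (by norm_cast)) hper i
  have h1 : ∀ x, pd i (fun x => F x * tchar (-k) x) x
      = pd i F x * tchar (-k) x - Dsym i k * (F x * tchar (-k) x) := by
    intro x
    have := ((hd x).hasFDerivAt.mul (hasFDerivAt_tchar (-k) x)).fderiv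
    unfold pd
    rw [show (fun x => F x * tchar (-k) x) = F * tchar (-k) from rfl, this]
    simp only [_root_.add_apply, _root_.smul_apply,
      _root_.sum_apply, coordC_apply, Pi.single_apply, smul_eq_mul, Dsym,
      Pi.neg_apply]
    fin_cases i <;> simp <;> ring
  simp_rw [h1] at h0
  have hintegrable : ∀ G : Vd 2 → ℂ, Continuous G → IntegrableOn G (box 2) := fun G hG =>
    hG.continuousOn.integrableOn_compact (isCompact_box 2)
  have e := integral_sub (hintegrable (fun x => pd i F x * tchar (-k) x)
    ((contDiff_pd hF i).continuous.mul (continuous_tchar _)))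
    (hintegrable (fun x => Dsym i k * (F x * tchar (-k) x)) (continuous_const.mul hpr.continuous))
  rw [h0, integral_const_mul, eq_comm, sub_eq_zero] at e
  rw [fCoeff_eq, fCoeff_eq, e]; ring

lemma exists_fCoeff_bound (hF : Continuous F) : ∃ C, ∀ k, ‖fCoeff F k‖ ≤ C := by
  obtain ⟨M, hM⟩ := (isCompact_box 2).exists_bound_of_continuousOn hF.continuousOn
  refine ⟨‖((2 * (Real.pi : ℂ)) ^ 2)⁻¹‖ * (M * volume.real (box 2)), fun k => ?_⟩
  rw [fCoeff_eq, norm_mul]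
  refine mul_le_mul_of_nonneg_left ?_ (norm_nonneg _)
  refine norm_setIntegral_le_of_norm_le_const (isCompact_box 2).measure_lt_top fun x hx => ?_
  rw [norm_mul, norm_tchar, mul_one]
  exact hM x hx

lemma exists_pow_mul_fCoeff_bound (n : ℕ) (i : Fin 2) : ∀ {F : Vd 2 → ℂ},
    ContDiff ℝ (⊤ : ℕ∞) F → TorusFun F → ∃ C, ∀ k, ‖k i‖ ^ n * ‖fCoeff F k‖ ≤ C := by
  induction n with
  | zero => intro F hF _; simpa using exists_fCoeff_bound hF.continuous
  | succ n ih =>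
    intro F hF hp
    obtain ⟨C, hC⟩ := ih (contDiff_pd hF i) (hp.pd i)
    refine ⟨C, fun k => ?_⟩
    have := hC k
    have h2 : ‖Dsym i k‖ = ‖k i‖ := by simp [Dsym, Int.norm_eq_abs]
    rwa [fCoeff_pd hF hp, norm_mul, h2, ← mul_assoc, ← pow_succ] at this

lemma rapid_fCoeff (hF : ContDiff ℝ (⊤ : ℕ∞) F) (hp : TorusFun F) : Rapid id (fCoeff F) := by
  intro n
  obtain ⟨C0, h0⟩ := exists_pow_mul_fCoeff_bound (n + 3) 0 hF hp
  obtain ⟨C1, h1⟩ := exists_pow_mul_fCoeff_bound (n + 3) 1 hF hp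
  have hs := (EisensteinSeries.summable_one_div_norm_rpow (k := 3) (by norm_num)).mul_left
    (2 ^ n * (C0 + C1))
  refine Summable.of_norm_bounded_eventually hs ?_
  filter_upwards [(Set.finite_singleton (0 : Fin 2 → ℤ)).compl_mem_cofinite] with k hk
  have hk0 : k ≠ 0 := hk
  have hk1 : 1 ≤ ‖k‖ := by
    obtain ⟨i, hi⟩ := Function.ne_iff.1 hk0
    refine le_trans ?_ (norm_le_pi_norm k i)
    rw [Int.norm_eq_abs]
    exact_mod_cast Int.one_le_abs hi
  have hpos : 0 < ‖k‖ := by linarith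
  have hC0 : 0 ≤ C0 := le_trans (by positivity) (h0 0)
  have hC1 : 0 ≤ C1 := le_trans (by positivity) (h1 0)
  have key : ‖k‖ ^ (n + 3) * ‖fCoeff F k‖ ≤ C0 + C1 := by
    obtain ⟨i, hi⟩ : ∃ i, ‖k‖ = ‖k i‖ := by
      obtain ⟨i, hi⟩ := Finite.exists_max fun i => ‖k i‖
      exact ⟨i, le_antisymm ((pi_norm_le_iff_of_nonneg (norm_nonneg _)).2 hi)
        (norm_le_pi_norm k i)⟩
    rw [hi]
    have h01 : ∀ i, ‖k i‖ ^ (n + 3) * ‖fCoeff F k‖ ≤ C0 + C1 :=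
      Fin.forall_fin_two.2 ⟨by linarith [h0 k], by linarith [h1 k]⟩
    exact h01 i
  rw [Real.rpow_neg (norm_nonneg _), ← div_eq_mul_inv, le_div_iff₀ (by positivity)]
  have h3 : ‖k‖ ^ (3 : ℝ) = ‖k‖ ^ 3 := by norm_cast
  rw [h3, Real.norm_of_nonneg (by positivity), id]
  calc (1 + ‖k‖) ^ n * ‖fCoeff F k‖ * ‖k‖ ^ 3
      ≤ (2 * ‖k‖) ^ n * ‖fCoeff F k‖ * ‖k‖ ^ 3 := by gcongr; linarith
    _ = 2 ^ n * (‖k‖ ^ (n + 3) * ‖fCoeff F k‖) := by rw [mul_pow, pow_add]; ring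
    _ ≤ _ := by gcongr

lemma eq_trig (hF : ContDiff ℝ (⊤ : ℕ∞) F) (hp : TorusFun F) : F = trig id (fCoeff F) :=
  eq_trig_fCoeff hF.continuous hp (rapid_fCoeff hF hp).summable.of_norm

end Inversion

/-! ### The bilinear operator and derivatives of trigonometric series -/

lemma kAbs_zero : kAbs (0 : Fin 2 → ℤ) = 0 := by simp [kAbs_eq]

lemma kAbs_le (k : Fin 2 → ℤ) : kAbs k ≤ 2 * (1 + ‖k‖) ^ 1 := by
  have h0 : |(k 0 : ℝ)| ≤ ‖k‖ := by simpa [Int.norm_eq_abs] using norm_le_pi_norm k 0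
  have h1 : |(k 1 : ℝ)| ≤ ‖k‖ := by simpa [Int.norm_eq_abs] using norm_le_pi_norm k 1
  have h2 := norm_nonneg k
  refine abs_le_of_sq_le_sq' ?_ (by positivity) |>.2
  rw [kAbs_sq]
  have := sq_le_sq' (by linarith [abs_nonneg (k 0 : ℝ)]) h0
  have := sq_le_sq' (by linarith [abs_nonneg (k 1 : ℝ)]) h1
  rw [sq_abs] at *
  nlinarith

section Derivatives

variable {ι ι' : Type*} {κ : ι → Fin 2 → ℤ} {κ' : ι' → Fin 2 → ℤ} {c a : ι → ℂ} {b : ι' → ℂ}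

lemma Rapid.kAbs (hc : Rapid κ c) : Rapid κ fun j => (kAbs (κ j) : ℂ) * c j :=
  hc.mul fun j => by
    rw [Complex.norm_real, Real.norm_of_nonneg (kAbs_nonneg _)]; exact kAbs_le _

lemma Lam1_trig [Countable ι] (hc : Rapid κ c) :
    Lam1 (trig κ c) = trig κ fun j => (kAbs (κ j) : ℂ) * c j := by
  have e : (fun k : Fin 2 → ℤ => if k = 0 then (0 : ℂ) else ((kAbs k ^ (1 : ℝ) : ℝ) : ℂ))
      = fun k => (kAbs k : ℂ) := by
    funext k
    split_ifs with h
    · rw [h, kAbs_zero]; simp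
    · rw [Real.rpow_one]
  rw [Lam1, LamPow, e]
  exact fmul_trig hc.summable hc.kAbs.summable

lemma Tbil_trig [Countable ι] [Countable ι'] (ha : Rapid κ a) (hb : Rapid κ' b) :
    Tbil (trig κ a) (trig κ' b)
      = trig (pairFreq κ κ') fun p => Tsym (κ p.1) (κ' p.2) * (a p.1 * b p.2) := by
  have h1 := ha.kAbs.pair hb
  have h2 := (ha.pair hb.kAbs).const_mul (-1)
  have h12 := h1.add h2
  have e : (fun x => Lam1 (trig κ a) x * trig κ' b x - trig κ a x * Lam1 (trig κ' b) x)
      = trig (pairFreq κ κ') fun p => (_root_.kAbs (κ p.1) : ℂ) * a p.1 * b p.2 +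
          -1 * (a p.1 * ((_root_.kAbs (κ' p.2) : ℂ) * b p.2)) := by
    funext x
    rw [trig_add h1.summable h2.summable, trig_const_mul, trig_pair ha.kAbs hb,
      trig_pair ha hb.kAbs, Lam1_trig ha, Lam1_trig hb]
    ring
  set d : ι × ι' → ℂ := fun p => (_root_.kAbs (κ p.1) : ℂ) * a p.1 * b p.2 +
    -1 * (a p.1 * ((_root_.kAbs (κ' p.2) : ℂ) * b p.2)) with hd
  set m : (Fin 2 → ℤ) → ℂ := fun k => if k = 0 then 0 else ((_root_.kAbs k ^ (-1 : ℝ) : ℝ) : ℂ)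
    with hm
  have es : (fun p => m (pairFreq κ κ' p) * d p)
      = fun p => Tsym (κ p.1) (κ' p.2) * (a p.1 * b p.2) := by
    funext p
    rw [Tsym, ← pairFreq, hm, hd]
    beta_reduce
    split_ifs with h
    · rw [h, kAbs_zero]; simp
    · rw [Real.rpow_neg_one]; push_cast; ring
  have hs : Summable fun p => ‖m (pairFreq κ κ' p) * d p‖ := by
    have := ((ha.pair hb).mul_bdd (m := fun p => Tsym (κ p.1) (κ' p.2))
      fun p => norm_Tsym_le _ _).summable
    exact this.congr fun p => by rw [congrFun es p]
  rw [Tbil, e, ← es]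
  exact fmul_trig h12.summable hs

lemma contDiff_trig (n : ℕ) : ∀ {c : ι → ℂ}, Rapid κ c → ContDiff ℝ n (trig κ c) := by
  induction n with
  | zero =>
    intro c hc
    exact contDiff_zero.2 (continuous_trig hc.summable)
  | succ n ih =>
    intro c hc
    push_cast
    rw [contDiff_succ_iff_fderiv]
    refine ⟨fun x => (hasFDerivAt_trig hc x).differentiableAt, by simp, ?_⟩
    rw [funext fun x => (hasFDerivAt_trig hc x).fderiv]
    exact ContDiff.sum fun i _ => (ih (hc.Dsym i)).smul contDiff_const

lemma iteratedFDeriv_trig (hc : Rapid κ c) (n : ℕ) : ∀ (x : Vd 2) (v : Fin n → Vd 2),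
    iteratedFDeriv ℝ n (trig κ c) x v = ∑ w : Fin n → Fin 2,
      (∏ j, (v j (w j) : ℂ)) * trig κ (fun j => wsym w (κ j) * c j) x := by
  induction n with
  | zero => intro x v; simp [wsym]
  | succ n ih =>
    intro x v
    have hd : DifferentiableAt ℝ (iteratedFDeriv ℝ n (trig κ c)) x :=
      ((contDiff_trig (n + 1) hc).differentiable_iteratedFDeriv (by norm_cast; omega)) x
    rw [iteratedFDeriv_succ_apply_left,
      ← fderiv_continuousMultilinear_apply_const_apply hd (Fin.tail v) (v 0)]
    have hsum : HasFDerivAt (fun y => iteratedFDeriv ℝ n (trig κ c) y (Fin.tail v))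
        (∑ w : Fin n → Fin 2, (∏ j, (Fin.tail v j (w j) : ℂ)) •
          ∑ i, trig κ (fun j => Dsym i (κ j) * (wsym w (κ j) * c j)) x • coordC i) x := by
      simp_rw [ih]
      exact HasFDerivAt.fun_sum fun w _ => (hasFDerivAt_trig (hc.wsym w) x).const_mul _
    rw [hsum.fderiv, ← (Fin.consEquiv fun _ : Fin (n + 1) => Fin 2).sum_comp,
      Fintype.sum_prod_type, Finset.sum_comm]
    simp only [_root_.sum_apply, _root_.smul_apply, coordC_apply, smul_eq_mul, Finset.mul_sum]
    refine Finset.sum_congr rfl fun w _ => Finset.sum_congr rfl fun i _ => ?_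
    simp only [Fin.consEquiv, Equiv.coe_fn_mk, wsym_cons, Fin.prod_univ_succ, Fin.cons_zero,
      Fin.cons_succ, Fin.tail, mul_assoc]
    ring

lemma norm_sum_word_le {n : ℕ} (v : Fin n → Vd 2) (t : (Fin n → Fin 2) → ℂ) :
    ‖∑ w : Fin n → Fin 2, (∏ j, (v j (w j) : ℂ)) * t w‖ ≤ (∑ w, ‖t w‖) * ∏ j, ‖v j‖ := by
  rw [Finset.sum_mul]
  refine norm_sum_le_of_le _ fun w _ => ?_
  rw [norm_mul, mul_comm, norm_prod]
  refine mul_le_mul_of_nonneg_left ?_ (norm_nonneg _)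
  refine Finset.prod_le_prod (fun _ _ => norm_nonneg _) fun j _ => ?_
  rw [Complex.norm_real]
  exact norm_le_pi_norm (v j) (w j)

lemma norm_iteratedFDeriv_trig_le (hc : Rapid κ c) (n : ℕ) (x : Vd 2) :
    ‖iteratedFDeriv ℝ n (trig κ c) x‖
      ≤ ∑ w : Fin n → Fin 2, ‖trig κ (fun j => wsym w (κ j) * c j) x‖ := by
  refine ContinuousMultilinearMap.opNorm_le_bound (by positivity) fun v => ?_
  rw [iteratedFDeriv_trig hc]
  exact norm_sum_word_le v _

lemma norm_iteratedFDeriv_trig_sub_le (hc : Rapid κ c) (n : ℕ) (x y : Vd 2) :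
    ‖iteratedFDeriv ℝ n (trig κ c) x - iteratedFDeriv ℝ n (trig κ c) y‖
      ≤ ∑ w : Fin n → Fin 2, ‖trig κ (fun j => wsym w (κ j) * c j) x
          - trig κ (fun j => wsym w (κ j) * c j) y‖ := by
  refine ContinuousMultilinearMap.opNorm_le_bound (by positivity) fun v => ?_
  rw [_root_.sub_apply, iteratedFDeriv_trig hc, iteratedFDeriv_trig hc,
    ← Finset.sum_sub_distrib]
  simp_rw [← mul_sub]
  exact norm_sum_word_le v _

/-- The tuple of unit coordinate vectors along the word `w`. -/
def wordVec {n : ℕ} (w : Fin n → Fin 2) (j : Fin n) : Vd 2 := Pi.single (w j) 1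

lemma prod_norm_wordVec {n : ℕ} (w : Fin n → Fin 2) : ∏ j, ‖wordVec w j‖ = 1 := by
  refine Finset.prod_eq_one fun j _ => ?_
  rw [wordVec, Pi.norm_single, norm_one]

lemma iteratedFDeriv_trig_wordVec (hc : Rapid κ c) {n : ℕ} (w : Fin n → Fin 2) (x : Vd 2) :
    iteratedFDeriv ℝ n (trig κ c) x (wordVec w) = trig κ (fun j => wsym w (κ j) * c j) x := by
  rw [iteratedFDeriv_trig hc, Finset.sum_eq_single w]
  · simp [wordVec]
  · intro w' _ hw
    obtain ⟨j, hj⟩ := Function.ne_iff.1 hw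
    rw [Finset.prod_eq_zero (Finset.mem_univ j), zero_mul]
    simp [wordVec, hj]
  · simp

end Derivatives

/-! ### Hölder norms of smooth periodic functions and of trigonometric series -/

section Comparison

variable {α A : ℝ} {n N : ℕ} {f : Vd 2 → ℝ}

lemma bddAbove_hSemi {F : Type*} [NormedAddCommGroup F] {G : Vd 2 → F}
    (h : ∀ x y, ‖G x - G y‖ ≤ A * ‖x - y‖ ^ α) :
    ∀ p : Vd 2 × Vd 2, (if p.1 = p.2 then 0 else ‖G p.1 - G p.2‖ / ‖p.1 - p.2‖ ^ α) ≤ max A 0 := by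
  intro p
  split_ifs with hp
  · exact le_max_right _ _
  · refine le_max_of_le_left ?_
    rw [div_le_iff₀ (Real.rpow_pos_of_pos (norm_pos_iff.2 (sub_ne_zero.2 hp)) α)]
    exact h _ _

lemma hSemi_le {F : Type*} [NormedAddCommGroup F] {G : Vd 2 → F} (hA : 0 ≤ A)
    (h : ∀ x y, ‖G x - G y‖ ≤ A * ‖x - y‖ ^ α) : hSemi α G ≤ A :=
  ciSup_le fun p => (bddAbove_hSemi h p).trans_eq (max_eq_left hA)

lemma norm_sub_le_hSemi {F : Type*} [NormedAddCommGroup F] {G : Vd 2 → F}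
    (h : ∀ x y, ‖G x - G y‖ ≤ A * ‖x - y‖ ^ α) (x y : Vd 2) :
    ‖G x - G y‖ ≤ hSemi α G * ‖x - y‖ ^ α := by
  rcases eq_or_ne x y with rfl | hxy
  · simp only [sub_self, norm_zero]
    exact mul_nonneg (Real.iSup_nonneg fun p => by split_ifs <;> positivity)
      (Real.rpow_nonneg le_rfl _)
  · have := le_ciSup (f := fun p : Vd 2 × Vd 2 =>
      if p.1 = p.2 then 0 else ‖G p.1 - G p.2‖ / ‖p.1 - p.2‖ ^ α)
      ⟨_, Set.forall_mem_range.2 (bddAbove_hSemi h)⟩ (x, y)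
    simp only [if_neg hxy] at this
    rwa [div_le_iff₀ (Real.rpow_pos_of_pos (norm_pos_iff.2 (sub_ne_zero.2 hxy)) α)] at this

lemma hSemi_nonneg {F : Type*} [NormedAddCommGroup F] (G : Vd 2 → F) : 0 ≤ hSemi α G :=
  Real.iSup_nonneg fun p => by split_ifs <;> positivity

lemma exists_norm_trig_sub_le {ι : Type*} {κ : ι → Fin 2 → ℤ} {c : ι → ℂ} (hα0 : 0 < α)
    (hα1 : α < 1) (hc : Rapid κ c) (n : ℕ) : ∃ A, (∀ x, ‖iteratedFDeriv ℝ n (trig κ c) x‖ ≤ A) ∧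
      ∀ x y, ‖iteratedFDeriv ℝ n (trig κ c) x - iteratedFDeriv ℝ n (trig κ c) y‖
        ≤ A * ‖x - y‖ ^ α := by
  choose B hB using fun w : Fin n → Fin 2 => exists_HB hα0 hα1 (hc.wsym w)
  refine ⟨∑ w, B w, fun x => ?_, fun x y => ?_⟩
  · exact (norm_iteratedFDeriv_trig_le hc n x).trans (Finset.sum_le_sum fun w _ => (hB w).1 x)
  · refine (norm_iteratedFDeriv_trig_sub_le hc n x y).trans ?_
    rw [Finset.sum_mul]
    refine Finset.sum_le_sum fun w _ => ?_
    simpa using (hB w).2 y (x - y)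

lemma HolNorm_trig_le {ι : Type*} {κ : ι → Fin 2 → ℤ} {c : ι → ℂ} {K : ℕ → ℝ} (hc : Rapid κ c)
    (h : ∀ n (w : Fin n → Fin 2), n ≤ N → HB α κ (fun j => wsym w (κ j) * c j) (K n)) :
    HolNorm N α (trig κ c) ≤ ∑ n ∈ Finset.range (N + 1), 2 ^ n * K n + 2 ^ N * K N := by
  refine add_le_add (Finset.sum_le_sum fun n hn => ciSup_le fun x => ?_) (hSemi_le ?_ ?_)
  · refine (norm_iteratedFDeriv_trig_le hc n x).trans ?_
    refine (Finset.sum_le_sum fun w _ =>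
      (h n w (Nat.lt_succ_iff.1 (Finset.mem_range.1 hn))).1 x).trans_eq ?_
    simp
  · exact mul_nonneg (by positivity) (h N (fun _ => 0) le_rfl).nonneg
  · intro x y
    refine (norm_iteratedFDeriv_trig_sub_le hc N x y).trans ?_
    refine (Finset.sum_le_sum fun w _ => ?_).trans_eq (b := ∑ _w : Fin N → Fin 2,
      K N * ‖x - y‖ ^ α) (by simp [mul_assoc])
    simpa using (h N w le_rfl).2 y (x - y)

lemma iteratedFDeriv_cplx_apply (hf : ContDiff ℝ (⊤ : ℕ∞) f) (n : ℕ) (x : Vd 2)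
    (v : Fin n → Vd 2) :
    iteratedFDeriv ℝ n (cplx f) x v = (iteratedFDeriv ℝ n f x v : ℂ) := by
  have := Complex.ofRealCLM.iteratedFDeriv_comp_left (n := (⊤ : ℕ∞)) hf.contDiffAt (x := x)
    (i := n) (by exact_mod_cast le_top)
  exact congrArg (fun m => m v) this

lemma norm_iteratedFDeriv_le_cplx (hf : ContDiff ℝ (⊤ : ℕ∞) f) (n : ℕ) (x : Vd 2) :
    ‖iteratedFDeriv ℝ n f x‖ ≤ ‖iteratedFDeriv ℝ n (cplx f) x‖ := by
  refine ContinuousMultilinearMap.opNorm_le_bound (norm_nonneg _) fun v => ?_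
  rw [← Complex.norm_real, ← iteratedFDeriv_cplx_apply hf]
  exact ContinuousMultilinearMap.le_opNorm _ v

lemma norm_iteratedFDeriv_sub_le_cplx (hf : ContDiff ℝ (⊤ : ℕ∞) f) (n : ℕ) (x y : Vd 2) :
    ‖iteratedFDeriv ℝ n f x - iteratedFDeriv ℝ n f y‖
      ≤ ‖iteratedFDeriv ℝ n (cplx f) x - iteratedFDeriv ℝ n (cplx f) y‖ := by
  refine ContinuousMultilinearMap.opNorm_le_bound (norm_nonneg _) fun v => ?_
  rw [← Complex.norm_real, _root_.sub_apply, Complex.ofReal_sub, ← iteratedFDeriv_cplx_apply hf,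
    ← iteratedFDeriv_cplx_apply hf, ← _root_.sub_apply]
  exact ContinuousMultilinearMap.le_opNorm _ v

lemma contDiff_cplx (hf : ContDiff ℝ (⊤ : ℕ∞) f) : ContDiff ℝ (⊤ : ℕ∞) (cplx f) :=
  Complex.ofRealCLM.contDiff.comp hf

lemma TorusFun.cplx (hp : TorusFun f) : TorusFun (cplx f) := fun x m => by
  simp only [_root_.cplx, hp x m]

lemma exists_iteratedFDeriv_bound (hα0 : 0 < α) (hα1 : α < 1) (hf : ContDiff ℝ (⊤ : ℕ∞) f)
    (hp : TorusFun f) (n : ℕ) : ∃ A, (∀ x, ‖iteratedFDeriv ℝ n f x‖ ≤ A) ∧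
      ∀ x y, ‖iteratedFDeriv ℝ n f x - iteratedFDeriv ℝ n f y‖ ≤ A * ‖x - y‖ ^ α := by
  have hr := rapid_fCoeff (contDiff_cplx hf) hp.cplx
  obtain ⟨A, h1, h2⟩ := exists_norm_trig_sub_le hα0 hα1 hr n
  rw [← eq_trig (contDiff_cplx hf) hp.cplx] at h1 h2
  exact ⟨A, fun x => (norm_iteratedFDeriv_le_cplx hf n x).trans (h1 x),
    fun x y => (norm_iteratedFDeriv_sub_le_cplx hf n x y).trans (h2 x y)⟩

lemma trig_wsym_fCoeff (hf : ContDiff ℝ (⊤ : ℕ∞) f) (hp : TorusFun f) (w : Fin n → Fin 2)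
    (x : Vd 2) : trig id (fun k => wsym w (id k) * fCoeff (cplx f) k) x
      = (iteratedFDeriv ℝ n f x (wordVec w) : ℂ) := by
  have hr := rapid_fCoeff (contDiff_cplx hf) hp.cplx
  rw [← iteratedFDeriv_trig_wordVec hr, ← eq_trig (contDiff_cplx hf) hp.cplx,
    iteratedFDeriv_cplx_apply hf]

lemma norm_trig_wsym_fCoeff_le (hf : ContDiff ℝ (⊤ : ℕ∞) f) (hp : TorusFun f)
    (w : Fin n → Fin 2) (x : Vd 2) :
    ‖trig id (fun k => wsym w (id k) * fCoeff (cplx f) k) x‖ ≤ ‖iteratedFDeriv ℝ n f x‖ := by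
  rw [trig_wsym_fCoeff hf hp, Complex.norm_real]
  simpa [prod_norm_wordVec] using (iteratedFDeriv ℝ n f x).le_opNorm (wordVec w)

lemma norm_trig_wsym_fCoeff_sub_le (hf : ContDiff ℝ (⊤ : ℕ∞) f) (hp : TorusFun f)
    (w : Fin n → Fin 2) (x y : Vd 2) :
    ‖trig id (fun k => wsym w (id k) * fCoeff (cplx f) k) x
      - trig id (fun k => wsym w (id k) * fCoeff (cplx f) k) y‖
      ≤ ‖iteratedFDeriv ℝ n f x - iteratedFDeriv ℝ n f y‖ := by
  rw [trig_wsym_fCoeff hf hp, trig_wsym_fCoeff hf hp, ← Complex.ofReal_sub, Complex.norm_real,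
    ← _root_.sub_apply]
  simpa [prod_norm_wordVec] using
    (iteratedFDeriv ℝ n f x - iteratedFDeriv ℝ n f y).le_opNorm (wordVec w)

lemma iSup_iteratedFDeriv_nonneg (n : ℕ) : 0 ≤ ⨆ x, ‖iteratedFDeriv ℝ n f x‖ :=
  Real.iSup_nonneg fun _ => norm_nonneg _

lemma HolNorm_nonneg : 0 ≤ HolNorm N α f :=
  add_nonneg (Finset.sum_nonneg fun n _ => iSup_iteratedFDeriv_nonneg n) (hSemi_nonneg _)

lemma derN_fCoeff_le (hα0 : 0 < α) (hα1 : α < 1) (hf : ContDiff ℝ (⊤ : ℕ∞) f) (hp : TorusFun f)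
    (hn : n ≤ N) : derN α id (fCoeff (cplx f)) n ≤ 2 * HolNorm N α f := by
  set S : ℕ → ℝ := fun m => ⨆ x, ‖iteratedFDeriv ℝ m f x‖ with hS
  have hS0 : ∀ m, 0 ≤ S m := iSup_iteratedFDeriv_nonneg
  have hle : ∀ m x, ‖iteratedFDeriv ℝ m f x‖ ≤ S m := fun m x => by
    obtain ⟨A, hA, -⟩ := exists_iteratedFDeriv_bound hα0 hα1 hf hp m
    exact le_ciSup (f := fun x => ‖iteratedFDeriv ℝ m f x‖) ⟨A, Set.forall_mem_range.2 hA⟩ x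
  have hH := hSemi_nonneg (α := α) (iteratedFDeriv ℝ N f)
  have hr := rapid_fCoeff (contDiff_cplx hf) hp.cplx
  refine ciSup_le fun w => ?_
  have h1 : ∀ x, ‖trig id (fun k => wsym w (id k) * fCoeff (cplx f) k) x‖ ≤ S n := fun x =>
    (norm_trig_wsym_fCoeff_le hf hp w x).trans (hle n x)
  rcases hn.eq_or_lt with rfl | hlt
  · obtain ⟨A, -, hA⟩ := exists_iteratedFDeriv_bound hα0 hα1 hf hp n
    have hSn : S n ≤ CkNorm n f :=
      Finset.single_le_sum (f := S) (fun m _ => hS0 m) (Finset.self_mem_range_succ n)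
    refine (hbN_le (A := S n + hSemi α (iteratedFDeriv ℝ n f))
      ⟨fun x => (h1 x).trans (by linarith), fun x v => ?_⟩).trans ?_
    · refine (norm_trig_wsym_fCoeff_sub_le hf hp w _ _).trans ?_
      refine (norm_sub_le_hSemi hA _ _).trans ?_
      rw [add_sub_cancel_left]
      have := hS0 n
      gcongr
      linarith
    · have := hS0 n
      unfold HolNorm
      linarith
  · have hSn : S n + S (n + 1) ≤ CkNorm N f := by
      rw [← Finset.sum_pair (f := S) (Nat.lt_succ_self n).ne]
      refine Finset.sum_le_sum_of_subset_of_nonneg (fun m hm => ?_) fun m _ _ => hS0 m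
      simp only [Finset.mem_insert, Finset.mem_singleton] at hm
      rw [Finset.mem_range]
      omega
    refine (hbN_le (A := 2 * S n + 2 * S (n + 1))
      ⟨fun x => (h1 x).trans (by linarith [hS0 n, hS0 (n + 1)]), fun x v => ?_⟩).trans ?_
    · refine le_rpow_of_le_of_le_mul hα0 hα1 (norm_nonneg v) ?_ ?_ (by linarith [hS0 n])
        (by linarith [hS0 (n + 1)])
      · exact (norm_sub_le _ _).trans (by linarith [h1 (x + v), h1 x])
      · refine norm_trig_diff_le (hr.wsym w) (fun i y => ?_) x v
        have := (norm_trig_wsym_fCoeff_le hf hp (Fin.cons i w : Fin (n + 1) → Fin 2) y).trans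
          (hle (n + 1) y)
        simpa only [wsym_cons, mul_assoc] using this
    · unfold HolNorm
      linarith

end Comparison

/-- Hölder estimates for the bilinear operator
`T[f,g] = Λ^{-1}((Λf)g - f(Λg))`:
`‖T[f,g]‖_{N+α} ≲ ‖f‖_{N+α}‖g‖_α + ‖f‖_α‖g‖_{N+α}`,
with implicit constant depending only on `α` and `N`. -/
theorem bilinear_T_holder_estimate (α : ℝ) (hα0 : 0 < α) (hα1 : α < 1) (N : ℕ) :
    ∃ C > 0, ∀ f g : Vd 2 → ℝ,
      ContDiff ℝ (⊤ : ℕ∞) f → ContDiff ℝ (⊤ : ℕ∞) g → TorusFun f → TorusFun g →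
      HolNorm N α (Tbil (cplx f) (cplx g)) ≤
        C * (HolNorm N α f * HolNorm 0 α g + HolNorm 0 α f * HolNorm N α g) := by
  have htC := tC_pos hα0 hα1
  set B : ℕ → ℝ := fun n => 2 ^ n * (tC α * (8 ^ n ^ 2 * 4)) with hB
  have hB0 : ∀ n, 0 < B n := fun n => by positivity
  refine ⟨∑ n ∈ Finset.range (N + 1), 2 ^ n * B n + 2 ^ N * B N, ?_, fun f g hf hg hpf hpg => ?_⟩
  · exact add_pos_of_nonneg_of_pos
      (Finset.sum_nonneg fun n _ => mul_nonneg (by positivity) (hB0 n).le)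
      (mul_pos (by positivity) (hB0 N))
  have ha := rapid_fCoeff (contDiff_cplx hf) hpf.cplx
  have hb := rapid_fCoeff (contDiff_cplx hg) hpg.cplx
  set X := HolNorm N α f * HolNorm 0 α g + HolNorm 0 α f * HolNorm N α g with hX
  have hT : Tbil (cplx f) (cplx g) = trig (pairFreq id id) fun p =>
      Tsym (id p.1) (id p.2) * (fCoeff (cplx f) p.1 * fCoeff (cplx g) p.2) := by
    conv_lhs => rw [eq_trig (contDiff_cplx hf) hpf.cplx, eq_trig (contDiff_cplx hg) hpg.cplx]
    exact Tbil_trig ha hb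
  have hc := (ha.pair hb).mul_bdd (m := fun p => Tsym (id p.1) (id p.2))
    fun p => norm_Tsym_le _ _
  rw [hT]
  refine (HolNorm_trig_le (N := N) (K := fun n => B n * X) hc fun n w hn => ?_).trans_eq ?_
  · refine (HB.wsym_Tsym hα0 hα1 ha hb w).mono ?_
    have h1 := derN_fCoeff_le hα0 hα1 hf hpf hn
    have h2 := derN_fCoeff_le hα0 hα1 hg hpg hn
    have h3 := derN_fCoeff_le (N := 0) hα0 hα1 hf hpf le_rfl
    have h4 := derN_fCoeff_le (N := 0) hα0 hα1 hg hpg le_rfl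
    have h5 := mul_le_mul h3 h2 (derN_nonneg _) (mul_nonneg zero_le_two HolNorm_nonneg)
    have h6 := mul_le_mul h1 h4 (derN_nonneg _) (mul_nonneg zero_le_two HolNorm_nonneg)
    simp only [hB, mul_assoc]
    gcongr
    rw [hX]
    linarith
  · rw [add_mul, Finset.sum_mul]
    simp only [mul_assoc]
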